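/- arXiv:2504.06248 — 8 statements merged into one kernel-verified Lean document; each statement's English description precedes it below -/
import Mathlib

section
/- If θ : I → ℝ^N is a solution of the Kuramoto model and z_j(t) := exp(i θ_j(t)) for each j, then z is differentiable and satisfies, for every j and t ∈ I, z_j'(t) = p_j(z(t)) + i ω_j z_j(t) − conj(p_j(z(t))) z_j(t)², where p_j(z) = (σ/2) Σ_{k=1}^N W_{jk} e^{−i α_{jk}} z_k. -/
/-- The Kuramoto vector field. -/
noncomputable def kuramotoF {N : ℕ} (W α : Fin N → Fin N → ℝ) (ω : Fin N → ℝ) (σ : ℝ)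
    (θ : Fin N → ℝ) : Fin N → ℝ :=
  fun j => ω j + σ * ∑ k, W j k * Real.sin (θ k - θ j - α j k)

/-- The complex coupling function `p_j(z) = (σ/2) Σ_k W_{jk} e^{-i α_{jk}} z_k`. -/
noncomputable def kuramotoP {N : ℕ} (W α : Fin N → Fin N → ℝ) (σ : ℝ)
    (z : Fin N → ℂ) (j : Fin N) : ℂ :=
  ((σ : ℂ) / 2) * ∑ k, (W j k : ℂ) * Complex.exp (-Complex.I * (α j k : ℂ)) * z k

/-- The product of `i sin(a - b - c)` with `e^{ib}`, written in terms of exponentials. -/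
theorem sin_sub_sub_mul_exp (a b c : ℂ) :
    2 * (Complex.sin (a - b - c) * (Complex.I * Complex.exp (Complex.I * b))) =
      Complex.exp (-Complex.I * c) * Complex.exp (Complex.I * a) -
        Complex.exp (Complex.I * c) * Complex.exp (-Complex.I * a) *
          Complex.exp (Complex.I * b) ^ 2 := by
  have h₁ : Complex.exp (-Complex.I * c) * Complex.exp (Complex.I * a) =
      Complex.exp ((a - b - c) * Complex.I) * Complex.exp (Complex.I * b) := by
    rw [← Complex.exp_add, ← Complex.exp_add]
    ring_nf
  have h₂ : Complex.exp (Complex.I * c) * Complex.exp (-Complex.I * a) *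
      Complex.exp (Complex.I * b) ^ 2 =
      Complex.exp (-(a - b - c) * Complex.I) * Complex.exp (Complex.I * b) := by
    rw [pow_two, ← Complex.exp_add, ← Complex.exp_add, ← Complex.exp_add, ← Complex.exp_add]
    ring_nf
  rw [h₁, h₂, Complex.sin]
  linear_combination (Complex.exp (-(a - b - c) * Complex.I) -
    Complex.exp ((a - b - c) * Complex.I)) * Complex.exp (Complex.I * b) * Complex.I_sq

/-- The coupling terms of the complex form agree with those of the Kuramoto vector field. -/
theorem kuramotoP_sub_conj_mul_sq {N : ℕ} (W α : Fin N → Fin N → ℝ) (σ : ℝ)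
    (x : Fin N → ℝ) (j : Fin N) :
    kuramotoP W α σ (fun k => Complex.exp (Complex.I * (x k : ℂ))) j -
        (starRingEnd ℂ) (kuramotoP W α σ (fun k => Complex.exp (Complex.I * (x k : ℂ))) j) *
          Complex.exp (Complex.I * (x j : ℂ)) ^ 2 =
      ((σ * ∑ k, W j k * Real.sin (x k - x j - α j k) : ℝ) : ℂ) *
        (Complex.I * Complex.exp (Complex.I * (x j : ℂ))) := by
  simp only [kuramotoP, map_mul, map_sum, map_div₀, map_neg, Complex.conj_ofReal, Complex.conj_I,
    map_ofNat, ← Complex.exp_conj, neg_neg]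
  push_cast
  simp only [Finset.mul_sum, Finset.sum_mul]
  rw [← Finset.sum_sub_distrib]
  refine Finset.sum_congr rfl fun k _ => ?_
  linear_combination (-(σ : ℂ) * W j k / 2) * sin_sub_sub_mul_exp (x k) (x j) (α j k)

/-- If `θ` solves the Kuramoto model, then `z_j = e^{iθ_j}` is differentiable and satisfies
`ż_j = p_j(z) + i ω_j z_j − conj(p_j(z)) z_j²`. -/
theorem kuramoto_complex_form (N : ℕ) (hN : 1 ≤ N)
    (W α : Fin N → Fin N → ℝ) (ω : Fin N → ℝ) (σ : ℝ)
    (hW : ∀ j, W j j = 0) (hα : ∀ j, α j j = 0)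
    (I : Set ℝ) (θ : ℝ → Fin N → ℝ)
    (hθ : ∀ t ∈ I, HasDerivAt θ (kuramotoF W α ω σ (θ t)) t) :
    ∀ t ∈ I, ∀ j : Fin N,
      HasDerivAt (fun s : ℝ => Complex.exp (Complex.I * (θ s j : ℂ)))
        (kuramotoP W α σ (fun k => Complex.exp (Complex.I * (θ t k : ℂ))) j
          + Complex.I * (ω j : ℂ) * Complex.exp (Complex.I * (θ t j : ℂ))
          - (starRingEnd ℂ)
              (kuramotoP W α σ (fun k => Complex.exp (Complex.I * (θ t k : ℂ))) j)
            * (Complex.exp (Complex.I * (θ t j : ℂ))) ^ 2) t := by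
  intro t ht j
  convert ((hasDerivAt_pi.mp (hθ t ht) j).ofReal_comp.const_mul Complex.I).cexp using 1
  rw [add_sub_right_comm, kuramotoP_sub_conj_mul_sq, kuramotoF]
  push_cast
  ring
end

section
/- Suppose μ_1, …, μ_q ∈ ℝ^N are linearly independent vectors such that for each ρ ∈ {1,…,q}, the identity Σ_{j=1}^N (μ_ρ)_j F_j(θ) = μ_ρ · ω holds for all θ ∈ ℝ^N, and suppose λ_ρ := μ_ρ · ω ≠ 0 for every ρ. Then there exist q − 1 linearly independent vectors ν_1, …, ν_{q−1} in the span of μ_1,…,μ_q such that for every τ, Σ_{j=1}^N (ν_τ)_j F_j(θ) = 0 for all θ ∈ ℝ^N; consequently, for every solution θ of θ' = F(θ) on an interval, each function t ↦ Σ_{j} (ν_τ)_j θ_j(t) is constant. -/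
/-- Subtracting multiples of the first vector from the others preserves independence. -/
theorem LinearIndependent.succ_sub_smul_zero {R M : Type*} [Ring R] [AddCommGroup M] [Module R M]
    {m : ℕ} {v : Fin (m + 1) → M} (hv : LinearIndependent R v) (c : Fin m → R) :
    LinearIndependent R fun i => v i.succ - c i • v 0 := by
  rw [Fintype.linearIndependent_iff] at hv ⊢
  intro g hg i
  have h := hv (Fin.cons (-∑ i, g i * c i) g) (by
    rw [← hg, Fin.sum_univ_succ]
    simp only [Fin.cons_zero, Fin.cons_succ, neg_smul, Finset.sum_smul, smul_sub,
      Finset.sum_sub_distrib, smul_smul]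
    abel) i.succ
  simpa using h

/-- A linear functional annihilating the velocity of a curve is constant along that curve. -/
theorem Convex.sum_mul_eq_of_hasDerivAt {ι : Type*} [Fintype ι] {I : Set ℝ} (hI : Convex ℝ I)
    {θ θ' : ℝ → ι → ℝ} (hθ : ∀ t ∈ I, HasDerivAt θ (θ' t) t) {v : ι → ℝ}
    (hv : ∀ t ∈ I, ∑ j, v j * θ' t j = 0) {s t : ℝ} (hs : s ∈ I) (ht : t ∈ I) :
    ∑ j, v j * θ s j = ∑ j, v j * θ t j := by
  have hderiv : ∀ x ∈ I, HasDerivWithinAt (fun x => ∑ j, v j * θ x j) 0 I x := by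
    intro x hx
    rw [← hv x hx]
    exact (HasDerivAt.fun_sum fun j _ =>
      (hasDerivAt_pi.1 (hθ x hx) j).const_mul (v j)).hasDerivWithinAt
  have h := hI.norm_image_sub_le_of_norm_hasDerivWithin_le (C := 0) hderiv (by simp) ht hs
  rw [zero_mul] at h
  exact sub_eq_zero.1 (norm_le_zero_iff.1 h)

/-- From `q` independent monomial eigenfunctions with nonzero eigenvalues one constructs `q - 1`
independent monomial constants of motion. -/
theorem monomial_constants_of_motion (N q : ℕ) (hq : 1 ≤ q)
    (W α : Fin N → Fin N → ℝ) (ω : Fin N → ℝ) (σ : ℝ)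
    (hW : ∀ j, W j j = 0) (hα : ∀ j, α j j = 0)
    (μ : Fin q → Fin N → ℝ) (hind : LinearIndependent ℝ μ)
    (heig : ∀ ρ, ∀ θ : Fin N → ℝ,
      ∑ j, μ ρ j * kuramotoF W α ω σ θ j = ∑ j, μ ρ j * ω j)
    (hlam : ∀ ρ, ∑ j, μ ρ j * ω j ≠ 0) :
    ∃ ν : Fin (q - 1) → Fin N → ℝ,
      LinearIndependent ℝ ν ∧
      (∀ τ, ν τ ∈ Submodule.span ℝ (Set.range μ)) ∧
      (∀ τ, ∀ θ : Fin N → ℝ, ∑ j, ν τ j * kuramotoF W α ω σ θ j = 0) ∧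
      (∀ I : Set ℝ, Convex ℝ I → ∀ θ : ℝ → Fin N → ℝ,
        (∀ t ∈ I, HasDerivAt θ (kuramotoF W α ω σ (θ t)) t) →
        ∀ τ, ∀ s ∈ I, ∀ t ∈ I, ∑ j, ν τ j * θ s j = ∑ j, ν τ j * θ t j) := by
  obtain ⟨m, rfl⟩ := Nat.exists_eq_add_of_le' hq
  let c : Fin m → ℝ := fun τ => (∑ j, μ τ.succ j * ω j) / ∑ j, μ 0 j * ω j
  let ν : Fin m → Fin N → ℝ := fun τ => μ τ.succ - c τ • μ 0
  have hν : ∀ τ θ, ∑ j, ν τ j * kuramotoF W α ω σ θ j = 0 := by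
    intro τ θ
    simp only [ν, c, Pi.sub_apply, Pi.smul_apply, smul_eq_mul, sub_mul, mul_assoc,
      Finset.sum_sub_distrib, ← Finset.mul_sum, heig]
    rw [div_mul_cancel₀ _ (hlam 0), sub_self]
  refine ⟨ν, hind.succ_sub_smul_zero c, fun τ => ?_, hν, fun I hI θ hθ τ s hs t ht => ?_⟩
  · exact sub_mem (Submodule.subset_span ⟨_, rfl⟩)
      (Submodule.smul_mem _ _ (Submodule.subset_span ⟨_, rfl⟩))
  · exact hI.sum_mul_eq_of_hasDerivAt hθ (fun x _ => hν τ (θ x)) hs ht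
end

section
/- Let N ≥ 4, let a, b, c, d ∈ {1,…,N} be pairwise distinct, and let A be the complex matrix A_{jk} = (σ/2) W_{jk} e^{−i α_{jk}} + (i/2) ω_j δ_{jk}. Then the identity Σ_{j=1}^N F_j(θ) ∂C_{abcd}/∂θ_j(θ) = 0 holds for all θ ∈ ℝ^N at which C_{abcd} is defined (i.e., the cross-ratio is a constant of motion of the Kuramoto model) if and only if the following three conditions hold: (1) A_{ba} = A_{ca} = A_{da} =: 𝒜_a, A_{ab} = A_{cb} = A_{db} =: 𝒜_b, A_{ac} = A_{bc} = A_{dc} =: 𝒜_c, A_{ad} = A_{bd} = A_{cd} =: 𝒜_d; (2) A_{ak} = A_{bk} = A_{ck} = A_{dk} for all k ∈ {1,…,N} \ {a,b,c,d}; (3) ω_j − 2 Im(𝒜_j) takes the same value for all j ∈ {a,b,c,d}. -/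
/-- The complex interaction matrix `A_{jk} = (σ/2) W_{jk} e^{-i α_{jk}} + (i/2) ω_j δ_{jk}`. -/
noncomputable def kuramotoA {N : ℕ} (W α : Fin N → Fin N → ℝ) (ω : Fin N → ℝ) (σ : ℝ)
    (j k : Fin N) : ℂ :=
  ((σ : ℂ) / 2) * (W j k : ℂ) * Complex.exp (-Complex.I * (α j k : ℂ))
    + (Complex.I / 2) * (ω j : ℂ) * (if j = k then 1 else 0)

/-- The phase cross-ratio of four oscillators. -/
noncomputable def crossRatioTheta {N : ℕ} (a b c d : Fin N) (θ : Fin N → ℝ) : ℝ :=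
  (Real.sin ((θ c - θ a) / 2) * Real.sin ((θ d - θ b) / 2)) /
    (Real.sin ((θ c - θ b) / 2) * Real.sin ((θ d - θ a) / 2))

open Real in
/-- The numerator of the derivative of the cross-ratio along a direction `v`. -/
noncomputable def crossRatioForm {N : ℕ} (a b c d : Fin N) (θ v : Fin N → ℝ) : ℝ :=
  sin ((θ d - θ b) / 2) * sin ((θ c - θ b) / 2) * sin ((θ c - θ d) / 2) * v a
    + sin ((θ c - θ a) / 2) * sin ((θ d - θ a) / 2) * sin ((θ d - θ c) / 2) * v b
    + sin ((θ d - θ b) / 2) * sin ((θ d - θ a) / 2) * sin ((θ a - θ b) / 2) * v c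
    + sin ((θ c - θ a) / 2) * sin ((θ c - θ b) / 2) * sin ((θ b - θ a) / 2) * v d

open Real in
theorem fderiv_crossRatioTheta_apply {N : ℕ} (a b c d : Fin N) (θ v : Fin N → ℝ)
    (h : sin ((θ c - θ b) / 2) * sin ((θ d - θ a) / 2) ≠ 0) :
    fderiv ℝ (crossRatioTheta a b c d) θ v =
      crossRatioForm a b c d θ v /
        (2 * (sin ((θ c - θ b) / 2) * sin ((θ d - θ a) / 2)) ^ 2) := by
  have hdiff : DifferentiableAt ℝ (crossRatioTheta a b c d) θ := by
    unfold crossRatioTheta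
    simp only [div_eq_mul_inv (_ * _)]
    exact DifferentiableAt.fun_mul (by fun_prop)
      (DifferentiableAt.fun_inv (by fun_prop) h)
  rw [← hdiff.lineDeriv_eq_fderiv, lineDeriv]
  have hsin : ∀ i j : Fin N, HasDerivAt (fun t : ℝ => sin (((θ + t • v) i - (θ + t • v) j) / 2))
      (cos ((θ i - θ j) / 2) * ((v i - v j) / 2)) 0 := by
    intro i j
    have hlin : ∀ i, HasDerivAt (fun t : ℝ => (θ + t • v) i) (v i) 0 := by
      intro i
      simpa using ((hasDerivAt_id (0 : ℝ)).mul_const (v i)).const_add (θ i)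
    simpa using (((hlin i).sub (hlin j)).div_const 2).sin
  have hderiv := ((hsin c a).mul (hsin d b)).div ((hsin c b).mul (hsin d a)) (by simpa using h)
  have heq : (fun t : ℝ => crossRatioTheta a b c d (θ + t • v)) =
      ((fun t : ℝ => sin (((θ + t • v) c - (θ + t • v) a) / 2)) *
        fun t : ℝ => sin (((θ + t • v) d - (θ + t • v) b) / 2)) /
      ((fun t : ℝ => sin (((θ + t • v) c - (θ + t • v) b) / 2)) *
        fun t : ℝ => sin (((θ + t • v) d - (θ + t • v) a) / 2)) := rfl
  rw [heq, hderiv.deriv]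
  simp only [zero_smul, add_zero, Pi.mul_apply]
  rw [div_eq_div_iff (pow_ne_zero 2 h) (mul_ne_zero two_ne_zero (pow_ne_zero 2 h)), mul_comm 2,
    ← mul_assoc, mul_right_comm]
  congr 1
  unfold crossRatioForm
  have hdc : sin ((θ d - θ c) / 2) = sin ((θ d - θ b) / 2 - (θ c - θ b) / 2) := by congr 1; ring
  have hcd : sin ((θ c - θ d) / 2) = sin ((θ c - θ a) / 2 - (θ d - θ a) / 2) := by congr 1; ring
  have hab : sin ((θ a - θ b) / 2) = sin ((θ c - θ b) / 2 - (θ c - θ a) / 2) := by congr 1; ring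
  have hba : sin ((θ b - θ a) / 2) = sin ((θ d - θ a) / 2 - (θ d - θ b) / 2) := by congr 1; ring
  rw [hdc, hcd, hab, hba]
  simp only [sin_sub]
  ring

open Real in
theorem crossRatioForm_moebius {N : ℕ} (a b c d : Fin N) (θ v : Fin N → ℝ) (u x y : ℝ)
    (ha : v a = u + x * cos (θ a) + y * sin (θ a)) (hb : v b = u + x * cos (θ b) + y * sin (θ b))
    (hc : v c = u + x * cos (θ c) + y * sin (θ c)) (hd : v d = u + x * cos (θ d) + y * sin (θ d)) :
    crossRatioForm a b c d θ v = 0 := by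
  have half : ∀ t : ℝ, u + x * cos t + y * sin t =
      u * (cos (t / 2) ^ 2 + sin (t / 2) ^ 2) + x * (cos (t / 2) ^ 2 - sin (t / 2) ^ 2)
        + y * (2 * sin (t / 2) * cos (t / 2)) := by
    intro t
    have hs : sin t = 2 * sin (t / 2) * cos (t / 2) := by rw [← sin_two_mul]; congr 1; ring
    have hco : cos t = cos (t / 2) ^ 2 - sin (t / 2) ^ 2 := by rw [← cos_two_mul']; congr 1; ring
    rw [hs, hco, cos_sq_add_sin_sq]; ring
  unfold crossRatioForm
  rw [ha, hb, hc, hd, half, half, half, half]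
  simp only [sub_div, sin_sub]
  ring

theorem kuramotoA_of_ne {N : ℕ} (W α : Fin N → Fin N → ℝ) (ω : Fin N → ℝ) (σ : ℝ)
    {j k : Fin N} (h : j ≠ k) :
    (kuramotoA W α ω σ j k).re = σ / 2 * W j k * Real.cos (α j k) ∧
      (kuramotoA W α ω σ j k).im = -(σ / 2 * W j k * Real.sin (α j k)) := by
  have hA : kuramotoA W α ω σ j k = ((σ / 2 * W j k * Real.cos (α j k) : ℝ) : ℂ)
      + ((-(σ / 2 * W j k * Real.sin (α j k)) : ℝ) : ℂ) * Complex.I := by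
    have he : -Complex.I * (α j k : ℂ) = ((-α j k : ℝ) : ℂ) * Complex.I := by push_cast; ring
    rw [kuramotoA, if_neg h, he, Complex.exp_mul_I, ← Complex.ofReal_cos, ← Complex.ofReal_sin,
      Real.cos_neg, Real.sin_neg]
    push_cast
    ring
  rw [hA]
  constructor <;>
    simp only [Complex.add_re, Complex.add_im, Complex.mul_re, Complex.mul_im, Complex.ofReal_re,
      Complex.ofReal_im, Complex.I_re, Complex.I_im] <;>
    ring

theorem kuramotoA_self {N : ℕ} (W α : Fin N → Fin N → ℝ) (ω : Fin N → ℝ) (σ : ℝ) (j : Fin N)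
    (hW : W j j = 0) :
    (kuramotoA W α ω σ j j).re = 0 ∧ (kuramotoA W α ω σ j j).im = ω j / 2 := by
  constructor <;> simp [kuramotoA, hW]; ring

open Real in
theorem kuramotoF_eq_sum {N : ℕ} (W α : Fin N → Fin N → ℝ) (ω : Fin N → ℝ) (σ : ℝ)
    (hW : ∀ j, W j j = 0) (θ : Fin N → ℝ) (j : Fin N) :
    kuramotoF W α ω σ θ j = 2 * ∑ k, ((kuramotoA W α ω σ j k).re * sin (θ k - θ j)
      + (kuramotoA W α ω σ j k).im * cos (θ k - θ j)) := by
  have hω : ω j = ∑ k, if k = j then ω j else 0 := by simp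
  rw [kuramotoF, hω, Finset.mul_sum, Finset.mul_sum, ← Finset.sum_add_distrib]
  refine Finset.sum_congr rfl fun k _ => ?_
  by_cases h : k = j
  · subst h
    obtain ⟨hre, him⟩ := kuramotoA_self W α ω σ k (hW k)
    simp [hre, him, hW]
    ring
  · obtain ⟨hre, him⟩ := kuramotoA_of_ne W α ω σ (Ne.symm h)
    rw [hre, him, if_neg h, sin_sub (θ k - θ j)]
    ring

open Real in
/-- If row `j` of the interaction matrix agrees off the diagonal with `R`, then the `j`-th component
of the field is a Möbius field in `θ j` with coefficients given by `R`. -/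
theorem kuramotoF_eq_moebius {N : ℕ} (W α : Fin N → Fin N → ℝ) (ω : Fin N → ℝ) (σ : ℝ)
    (hW : ∀ j, W j j = 0) (θ : Fin N → ℝ) (j : Fin N) (R : Fin N → ℂ)
    (hR : ∀ k, k ≠ j → kuramotoA W α ω σ j k = R k) :
    kuramotoF W α ω σ θ j = (ω j - 2 * (R j).im)
      + (2 * ∑ k, ((R k).re * sin (θ k) + (R k).im * cos (θ k))) * cos (θ j)
      + (2 * ∑ k, ((R k).im * sin (θ k) - (R k).re * cos (θ k))) * sin (θ j) := by
  have hω : ω j - 2 * (R j).im = ∑ k, if k = j then ω j - 2 * (R j).im else 0 := by simp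
  rw [kuramotoF_eq_sum W α ω σ hW, hω]
  simp only [Finset.mul_sum, Finset.sum_mul, ← Finset.sum_add_distrib]
  refine Finset.sum_congr rfl fun k _ => ?_
  by_cases h : k = j
  · subst h
    obtain ⟨hre, him⟩ := kuramotoA_self W α ω σ k (hW k)
    simp only [hre, him, if_true, sub_self, sin_zero, cos_zero]
    linear_combination -2 * (R k).im * sin_sq_add_cos_sq (θ k)
  · rw [hR k h, if_neg h, sin_sub, cos_sub]
    ring

theorem sum_apply_update {ι : Type*} [Fintype ι] [DecidableEq ι] (f : ι → ℝ → ℝ) (x : ι → ℝ)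
    (k : ι) (t : ℝ) :
    ∑ i, f i (Function.update x k t i) = (∑ i, f i (x i)) - f k (x k) + f k t := by
  rw [← Finset.add_sum_erase _ _ (Finset.mem_univ k),
    ← Finset.add_sum_erase Finset.univ (fun i => f i (x i)) (Finset.mem_univ k),
    Finset.sum_congr rfl fun i hi => by
      rw [Function.update_of_ne (Finset.ne_of_mem_erase hi)]]
  simp only [Function.update_self]
  ring

open Real in
/-- If the components `j` and `l` of the field agree whenever `θ j = θ l`, then the rows `j` and `l`
of the interaction matrix agree away from the columns `j` and `l`. -/
theorem kuramotoA_eq_of_kuramotoF_eq {N : ℕ} (W α : Fin N → Fin N → ℝ) (ω : Fin N → ℝ) (σ : ℝ)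
    (hW : ∀ j, W j j = 0) {j l m n : Fin N} (hjl : j ≠ l) (hjm : j ≠ m) (hjn : j ≠ n)
    (hlm : l ≠ m) (hln : l ≠ n) (hmn : m ≠ n)
    (h : ∀ θ : Fin N → ℝ, θ j = θ l → sin ((θ m - θ j) / 2) ≠ 0 → sin ((θ n - θ j) / 2) ≠ 0 →
      sin ((θ m - θ n) / 2) ≠ 0 → kuramotoF W α ω σ θ j = kuramotoF W α ω σ θ l) :
    (∀ k, k ≠ j → k ≠ l → kuramotoA W α ω σ j k = kuramotoA W α ω σ l k) ∧
      ω j + 2 * (kuramotoA W α ω σ j l).im = ω l + 2 * (kuramotoA W α ω σ l j).im := by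
  set B : Fin N → ℂ := fun k => kuramotoA W α ω σ j k - kuramotoA W α ω σ l k with hB
  let f : Fin N → ℝ → ℝ := fun k t => (B k).re * sin t + (B k).im * cos t
  have hpi := pi_pos
  have hsum : ∀ x : Fin N → ℝ, x j = 0 → x l = 0 → x m ≠ 0 → x n ≠ 0 → x m ≠ x n →
      |x m| ≤ π → |x n| ≤ π → |x m - x n| < 2 * π → ∑ k, f k (x k) = 0 := by
    intro x hxj hxl hxm hxn hxmn hbm hbn hbmn
    have hne : ∀ t : ℝ, t ≠ 0 → |t| < 2 * π → sin (t / 2) ≠ 0 := by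
      intro t ht hb hs
      rw [abs_lt] at hb
      have := (sin_eq_zero_iff_of_lt_of_lt (by linarith) (by linarith)).1 hs
      exact ht (by linarith)
    have hF := h x (by rw [hxj, hxl]) (by rw [hxj, sub_zero]; exact hne _ hxm (by linarith))
      (by rw [hxj, sub_zero]; exact hne _ hxn (by linarith)) (hne _ (sub_ne_zero.2 hxmn) hbmn)
    rw [kuramotoF_eq_sum W α ω σ hW, kuramotoF_eq_sum W α ω σ hW, hxj, hxl] at hF
    have hF' := mul_left_cancel₀ two_ne_zero hF
    rw [← sub_eq_zero, ← Finset.sum_sub_distrib] at hF'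
    rw [← hF']
    refine Finset.sum_congr rfl fun k _ => ?_
    simp only [f, hB, Complex.sub_re, Complex.sub_im, sub_zero]
    ring
  let x₀ : Fin N → ℝ := Function.update (Function.update 0 m (3 * π / 4)) n (π / 4)
  have hx₀m : x₀ m = 3 * π / 4 := by simp [x₀, hmn]
  have hx₀n : x₀ n = π / 4 := by simp [x₀]
  have hx₀j : x₀ j = 0 := by simp [x₀, hjm, hjn]
  have hx₀l : x₀ l = 0 := by simp [x₀, hlm, hln]
  have hx₀ : ∀ k, k ≠ m → k ≠ n → x₀ k = 0 := fun k hm hn => by simp [x₀, hm, hn]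
  have hupd : ∀ k, k ≠ j → k ≠ l → ∀ t : ℝ, t = π / 2 ∨ t = -(π / 2) ∨ t = π →
      (∑ i, f i (x₀ i)) - f k (x₀ k) + f k t = 0 := by
    intro k hkj hkl t ht
    rw [← sum_apply_update]
    have hum : Function.update x₀ k t m = t ∧ Function.update x₀ k t n = π / 4 ∨
        Function.update x₀ k t m = 3 * π / 4 ∧ Function.update x₀ k t n = t ∨
        Function.update x₀ k t m = 3 * π / 4 ∧ Function.update x₀ k t n = π / 4 := by
      by_cases hkm : k = m
      · subst hkm; simp [Function.update_of_ne hmn.symm, hx₀n]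
      · by_cases hkn : k = n
        · subst hkn; simp [Function.update_of_ne hmn, hx₀m]
        · simp [Function.update_of_ne (Ne.symm hkm), Function.update_of_ne (Ne.symm hkn), hx₀m,
            hx₀n]
    apply hsum
    · rw [Function.update_of_ne hkj.symm, hx₀j]
    · rw [Function.update_of_ne hkl.symm, hx₀l]
    all_goals
      rcases hum with ⟨h₁, h₂⟩ | ⟨h₁, h₂⟩ | ⟨h₁, h₂⟩ <;>
        simp only [h₁, h₂, abs_le, abs_lt] <;> rcases ht with rfl | rfl | rfl <;>
        first
          | (constructor <;> linarith)
          | (intro h0; linarith)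
  have hBzero : ∀ k, k ≠ j → k ≠ l → B k = 0 := by
    intro k hkj hkl
    have h₁ := hupd k hkj hkl _ (Or.inl rfl)
    have h₂ := hupd k hkj hkl _ (Or.inr (Or.inl rfl))
    have h₃ := hupd k hkj hkl _ (Or.inr (Or.inr rfl))
    generalize (∑ i, f i (x₀ i)) - f k (x₀ k) = s at h₁ h₂ h₃
    simp only [f, sin_neg, cos_neg, sin_pi_div_two, cos_pi_div_two, sin_pi, cos_pi] at h₁ h₂ h₃
    apply Complex.ext <;> simp only [Complex.zero_re, Complex.zero_im] <;> linarith
  refine ⟨fun k hkj hkl => sub_eq_zero.1 (hBzero k hkj hkl), ?_⟩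
  have hbase := hsum x₀ hx₀j hx₀l (by rw [hx₀m]; positivity) (by rw [hx₀n]; positivity)
    (by rw [hx₀m, hx₀n]; intro h0; linarith) (by rw [hx₀m, abs_le]; constructor <;> linarith)
    (by rw [hx₀n, abs_le]; constructor <;> linarith)
    (by rw [hx₀m, hx₀n, abs_lt]; constructor <;> linarith)
  rw [Fintype.sum_eq_add j l hjl fun k hk => by simp [f, hBzero k hk.1 hk.2]] at hbase
  simp only [f, hx₀j, hx₀l, sin_zero, cos_zero, hB, Complex.sub_im,
    (kuramotoA_self W α ω σ _ (hW _)).2] at hbase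
  linarith

/-- Theorem 2 (cross-ratio conservation): the cross-ratio `c_{abcd}` is a constant of motion of
the Kuramoto model iff the vertices `a,b,c,d` have the same outgoing interactions within
`{a,b,c,d}`, the same incoming interactions from outside, and the same shifted natural
frequencies. -/
theorem crossratio_conservation (N : ℕ) (hN : 4 ≤ N)
    (W α : Fin N → Fin N → ℝ) (ω : Fin N → ℝ) (σ : ℝ)
    (hW : ∀ j, W j j = 0) (hα : ∀ j, α j j = 0)
    (hαbound : ∀ j k, |α j k| ≤ Real.pi / 2)
    (a b c d : Fin N) (hab : a ≠ b) (hac : a ≠ c) (had : a ≠ d)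
    (hbc : b ≠ c) (hbd : b ≠ d) (hcd : c ≠ d) :
    (∀ θ : Fin N → ℝ,
        Real.sin ((θ c - θ b) / 2) * Real.sin ((θ d - θ a) / 2) ≠ 0 →
        ∑ j, kuramotoF W α ω σ θ j *
          fderiv ℝ (crossRatioTheta a b c d) θ (Pi.single j 1) = 0) ↔
      ((kuramotoA W α ω σ b a = kuramotoA W α ω σ c a ∧
          kuramotoA W α ω σ c a = kuramotoA W α ω σ d a) ∧
       (kuramotoA W α ω σ a b = kuramotoA W α ω σ c b ∧
          kuramotoA W α ω σ c b = kuramotoA W α ω σ d b) ∧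
       (kuramotoA W α ω σ a c = kuramotoA W α ω σ b c ∧
          kuramotoA W α ω σ b c = kuramotoA W α ω σ d c) ∧
       (kuramotoA W α ω σ a d = kuramotoA W α ω σ b d ∧
          kuramotoA W α ω σ b d = kuramotoA W α ω σ c d) ∧
       (∀ k, k ≠ a → k ≠ b → k ≠ c → k ≠ d →
          kuramotoA W α ω σ a k = kuramotoA W α ω σ b k ∧
          kuramotoA W α ω σ b k = kuramotoA W α ω σ c k ∧
          kuramotoA W α ω σ c k = kuramotoA W α ω σ d k) ∧
       (ω a - 2 * (kuramotoA W α ω σ b a).im = ω b - 2 * (kuramotoA W α ω σ a b).im ∧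
        ω b - 2 * (kuramotoA W α ω σ a b).im = ω c - 2 * (kuramotoA W α ω σ a c).im ∧
        ω c - 2 * (kuramotoA W α ω σ a c).im = ω d - 2 * (kuramotoA W α ω σ a d).im)) := by
  have hsum : ∀ θ : Fin N → ℝ,
      ∑ j, kuramotoF W α ω σ θ j * fderiv ℝ (crossRatioTheta a b c d) θ (Pi.single j 1) =
        fderiv ℝ (crossRatioTheta a b c d) θ (kuramotoF W α ω σ θ) := by
    intro θ
    conv_rhs => rw [pi_eq_sum_univ' (kuramotoF W α ω σ θ)]
    simp [map_sum]
  simp only [hsum]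
  constructor
  · intro h
    have hform : ∀ θ : Fin N → ℝ,
        Real.sin ((θ c - θ b) / 2) * Real.sin ((θ d - θ a) / 2) ≠ 0 →
        crossRatioForm a b c d θ (kuramotoF W α ω σ θ) = 0 := by
      intro θ hθ
      have h₀ := h θ hθ
      rw [fderiv_crossRatioTheta_apply a b c d θ _ hθ] at h₀
      exact (div_eq_zero_iff.1 h₀).resolve_right (mul_ne_zero two_ne_zero (pow_ne_zero 2 hθ))
    have hswap : ∀ s t : ℝ, Real.sin ((s - t) / 2) = -Real.sin ((t - s) / 2) := by
      intro s t
      rw [← Real.sin_neg]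
      congr 1
      ring
    obtain ⟨hAcd, hωcd⟩ := kuramotoA_eq_of_kuramotoF_eq W α ω σ hW hcd hac.symm hbc.symm
      had.symm hbd.symm hab (by
        intro θ he h₁ h₂ h₃
        have h₀ := hform θ (by rw [hswap, ← he, hswap (θ c)]; simp [h₁, h₂])
        simp only [crossRatioForm, ← he, sub_self, zero_div, Real.sin_zero] at h₀
        rw [hswap (θ c) (θ a), hswap (θ c) (θ b), hswap (θ b) (θ a)] at h₀
        refine mul_left_cancel₀ (mul_ne_zero (mul_ne_zero h₁ h₂) h₃) ?_
        linear_combination h₀)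
    obtain ⟨hAab, hωab⟩ := kuramotoA_eq_of_kuramotoF_eq W α ω σ hW hab hac had hbc hbd hcd (by
        intro θ he h₁ h₂ h₃
        have h₀ := hform θ (by rw [← he]; simp [h₁, h₂])
        simp only [crossRatioForm, ← he, sub_self, zero_div, Real.sin_zero] at h₀
        rw [hswap (θ d) (θ c)] at h₀
        refine mul_left_cancel₀ (mul_ne_zero (mul_ne_zero h₁ h₂) h₃) ?_
        linear_combination h₀)
    obtain ⟨hAac, hωac⟩ := kuramotoA_eq_of_kuramotoF_eq W α ω σ hW hac hab had hbc.symm hcd hbd (by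
        intro θ he h₁ h₂ h₃
        have h₀ := hform θ (by rw [hswap, ← he]; simp [h₁, h₂])
        simp only [crossRatioForm, ← he, sub_self, zero_div, Real.sin_zero] at h₀
        rw [hswap (θ d) (θ b), hswap (θ a) (θ b), hswap (θ a) (θ d)] at h₀
        refine mul_left_cancel₀ (mul_ne_zero (mul_ne_zero h₁ h₂) h₃) ?_
        linear_combination -h₀)
    obtain ⟨hAbd, hωbd⟩ := kuramotoA_eq_of_kuramotoF_eq W α ω σ hW hbd hab.symm hbc had.symm
      hcd.symm hac (by
        intro θ he h₁ h₂ h₃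
        have h₀ := hform θ (by rw [← he, hswap (θ b)]; simp [h₁, h₂])
        simp only [crossRatioForm, ← he, sub_self, zero_div, Real.sin_zero] at h₀
        rw [hswap (θ c) (θ a), hswap (θ b) (θ c), hswap (θ b) (θ a)] at h₀
        refine mul_left_cancel₀ (mul_ne_zero (mul_ne_zero h₁ h₂) h₃) ?_
        linear_combination -h₀)
    have ba_da := hAbd a hab had
    have ca_da := hAcd a hac had
    have ab_cb := hAac b hab.symm hbc
    have cb_db := hAcd b hbc hbd
    have ac_bc := hAab c hac.symm hbc.symm
    have bc_dc := hAbd c hbc.symm hcd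
    have ad_bd := hAab d had.symm hbd.symm
    have ad_cd := hAac d had.symm hcd.symm
    refine ⟨⟨ba_da.trans ca_da.symm, ca_da⟩, ⟨ab_cb, cb_db⟩, ⟨ac_bc, bc_dc⟩,
      ⟨ad_bd, ad_bd.symm.trans ad_cd⟩, fun k ka kb kc kd =>
        ⟨hAab k ka kb, (hAab k ka kb).symm.trans (hAac k ka kc), hAcd k kc kd⟩, ?_, ?_, ?_⟩
    · linarith
    · rw [ba_da, ← ca_da] at hωab
      linarith
    · rw [← bc_dc, ← ac_bc, ← ad_cd] at hωcd
      linarith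
  · rintro ⟨⟨ba_ca, ca_da⟩, ⟨ab_cb, cb_db⟩, ⟨ac_bc, bc_dc⟩, ⟨ad_bd, bd_cd⟩, hout, ω_ab, ω_bc, ω_cd⟩
      θ hθ
    rw [fderiv_crossRatioTheta_apply a b c d θ _ hθ]
    let R : Fin N → ℂ := fun k => if k = a then kuramotoA W α ω σ b a else kuramotoA W α ω σ a k
    have hRa : R a = kuramotoA W α ω σ b a := if_pos rfl
    have hR : ∀ k, k ≠ a → R k = kuramotoA W α ω σ a k := fun k hk => if_neg hk
    have hrow : ∀ j, j = a ∨ j = b ∨ j = c ∨ j = d →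
        ∀ k, k ≠ j → kuramotoA W α ω σ j k = R k := by
      intro j hj k hk
      by_cases ka : k = a
      · subst ka
        grind
      · rw [hR k ka]
        by_cases kb : k = b
        · subst kb; grind
        by_cases kc : k = c
        · subst kc; grind
        by_cases kd : k = d
        · subst kd; grind
        have := hout k ka kb kc kd
        grind
    have hF := fun j hj => kuramotoF_eq_moebius W α ω σ hW θ j R (hrow j hj)
    have hFa := hF a (by simp)
    have hFb := hF b (by simp)
    have hFc := hF c (by simp)
    have hFd := hF d (by simp)
    rw [hRa] at hFa
    rw [hR b hab.symm, ← ω_ab] at hFb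
    rw [hR c hac.symm, ← ω_bc, ← ω_ab] at hFc
    rw [hR d had.symm, ← ω_cd, ← ω_bc, ← ω_ab] at hFd
    rw [crossRatioForm_moebius a b c d θ _ _ _ _ hFa hFb hFc hFd, zero_div]
end

section
/- Let n ≥ 4 and, for each i ∈ {1,…,n−3}, let c_i : ℂ^n → ℂ be the cross-ratio c_i(z) = ((z_{i+2}−z_i)(z_{i+3}−z_{i+1}))/((z_{i+2}−z_{i+1})(z_{i+3}−z_i)) with consecutive indices i, i+1, i+2, i+3. Then for every z ∈ ℂ^n with pairwise distinct coordinates, the (n−3)×n complex Jacobian matrix (∂c_i/∂z_j(z)) has rank n − 3. In particular, the n − 3 cross-ratios c_{1234}, c_{2345}, …, c_{(n−3)(n−2)(n−1)n} are functionally independent. -/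
/-- The cross-ratio of four coordinates of a point of `ℂ^n`. -/
noncomputable def crossRatioC {n : ℕ} (a b c d : Fin n) (z : Fin n → ℂ) : ℂ :=
  ((z c - z a) * (z d - z b)) / ((z c - z b) * (z d - z a))

theorem differentiableAt_crossRatioC {n : ℕ} {a b c d : Fin n} {z : Fin n → ℂ}
    (hcb : z c ≠ z b) (hda : z d ≠ z a) : DifferentiableAt ℂ (crossRatioC a b c d) z := by
  have h : (z c - z b) * (z d - z a) ≠ 0 :=
    mul_ne_zero (sub_ne_zero.mpr hcb) (sub_ne_zero.mpr hda)
  unfold crossRatioC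
  fun_prop (disch := exact h)

/-- The cross-ratio does not depend on a coordinate other than its four arguments. -/
theorem fderiv_crossRatioC_single_of_ne {n : ℕ} {a b c d j : Fin n} {z : Fin n → ℂ}
    (hcb : z c ≠ z b) (hda : z d ≠ z a) (ha : a ≠ j) (hb : b ≠ j) (hc : c ≠ j) (hd : d ≠ j) :
    fderiv ℂ (crossRatioC a b c d) z (Pi.single j 1) = 0 := by
  rw [← (differentiableAt_crossRatioC hcb hda).lineDeriv_eq_fderiv]
  simp [lineDeriv, crossRatioC, ha, hb, hc, hd]

/-- The partial derivative of the cross-ratio with respect to its last argument. -/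
theorem fderiv_crossRatioC_single_last {n : ℕ} {a b c d : Fin n} {z : Fin n → ℂ}
    (hcb : z c ≠ z b) (hda : z d ≠ z a) (ha : a ≠ d) (hb : b ≠ d) (hc : c ≠ d) :
    fderiv ℂ (crossRatioC a b c d) z (Pi.single d 1) =
      (z c - z a) * (z b - z a) / ((z c - z b) * (z d - z a) ^ 2) := by
  rw [← (differentiableAt_crossRatioC hcb hda).lineDeriv_eq_fderiv]
  have h₁ : z c - z b ≠ 0 := sub_ne_zero.mpr hcb
  have h₂ : z d - z a ≠ 0 := sub_ne_zero.mpr hda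
  have hlin (w : ℂ) : HasDerivAt (fun t : ℂ => z d + t - w) 1 0 :=
    ((hasDerivAt_id (0 : ℂ)).const_add (z d)).sub_const w
  have hquot := ((hlin (z b)).const_mul (z c - z a)).fun_div
    ((hlin (z a)).const_mul (z c - z b)) (by simpa using ⟨h₁, h₂⟩)
  simp only [lineDeriv, crossRatioC, Pi.add_apply, Pi.smul_apply, Pi.single_eq_same,
    Pi.single_eq_of_ne ha, Pi.single_eq_of_ne hb, Pi.single_eq_of_ne hc, smul_eq_mul, mul_zero,
    mul_one, add_zero]
  rw [hquot.deriv]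
  simp only [add_zero]
  field_simp
  ring

/-- The `(n−3) × n` Jacobian matrix of the consecutive-index cross-ratios
`c_{1234}, c_{2345}, …, c_{(n−3)(n−2)(n−1)n}` has full rank `n − 3` at every point with
pairwise distinct coordinates; hence these cross-ratios are functionally independent. -/
theorem crossratio_jacobian_full_rank (n : ℕ) (hn : 4 ≤ n) (z : Fin n → ℂ)
    (hz : Function.Injective z) :
    Matrix.rank (Matrix.of fun (i : Fin (n - 3)) (j : Fin n) =>
      fderiv ℂ (crossRatioC
        (⟨i.1, by have := i.isLt; omega⟩ : Fin n)
        (⟨i.1 + 1, by have := i.isLt; omega⟩ : Fin n)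
        (⟨i.1 + 2, by have := i.isLt; omega⟩ : Fin n)
        (⟨i.1 + 3, by have := i.isLt; omega⟩ : Fin n)) z (Pi.single j 1)) = n - 3 := by
  have hne {k l : ℕ} (hk : k < n) (hl : l < n) (hkl : k ≠ l) : z ⟨k, hk⟩ ≠ z ⟨l, hl⟩ :=
    hz.ne (by simpa using hkl)
  apply le_antisymm (by simpa using Matrix.rank_le_height _)
  set M := Matrix.of fun (i : Fin (n - 3)) (j : Fin n) => _ with hM
  let e : Fin (n - 3) → Fin n := fun i => ⟨i.1 + 3, by omega⟩
  have hdet : (M.submatrix id e).det ≠ 0 := by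
    rw [Matrix.det_of_isLowerTriangular]
    · refine Finset.prod_ne_zero_iff.mpr fun i _ => ?_
      simp only [hM, Matrix.submatrix_apply, id_eq, Matrix.of_apply, e]
      rw [fderiv_crossRatioC_single_last (hne _ _ (by omega)) (hne _ _ (by omega))
        (by simp) (by simp) (by simp)]
      refine div_ne_zero (mul_ne_zero ?_ ?_) (mul_ne_zero ?_ (pow_ne_zero _ ?_)) <;>
        exact sub_ne_zero.mpr (hne _ _ (by omega))
    · intro i j hij
      have hlt : i.1 < j.1 := hij
      simp only [hM, Matrix.submatrix_apply, id_eq, Matrix.of_apply, e]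
      apply fderiv_crossRatioC_single_of_ne (hne _ _ (by omega)) (hne _ _ (by omega)) <;>
        simp only [ne_eq, Fin.mk.injEq] <;> omega
  calc n - 3 = (M.submatrix id e).rank := by
        rw [Matrix.rank_of_isUnit _ ((Matrix.isUnit_iff_isUnit_det _).mpr hdet.isUnit),
          Fintype.card_fin]
    _ ≤ M.rank := Matrix.rank_submatrix_le _ _ _
end

section
/- Let F, v : ℝ^N → ℝ^N be continuously differentiable vector fields whose Lie bracket vanishes, i.e., (Dv)(x)(F(x)) = (DF)(x)(v(x)) for all x ∈ ℝ^N, where D denotes the Fréchet derivative. Suppose Φ : ℝ × ℝ^N → ℝ^N is continuously differentiable with Φ(0, x) = x and ∂Φ/∂ε (ε, x) = v(Φ(ε, x)) for all (ε, x). Then for every differentiable curve y : I → ℝ^N satisfying y'(t) = F(y(t)) on an interval I, and for every ε ∈ ℝ, the curve t ↦ Φ(ε, y(t)) also satisfies the differential equation: d/dt Φ(ε, y(t)) = F(Φ(ε, y(t))) for all t ∈ I. Hence the flow of v is a Lie symmetry of the system ẏ = F(y). -/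
open Set Filter Topology

section

variable {E : Type*} [NormedAddCommGroup E] [NormedSpace ℝ E]

/-- Differentiation under the integral sign over a compact interval, for an integrand whose
partial derivative in the parameter is jointly continuous. -/
theorem hasDerivAt_intervalIntegral_of_continuous_deriv {g g' : ℝ → ℝ → E}
    (hg : ∀ r, Continuous (g r)) (hg' : Continuous (Function.uncurry g'))
    (hd : ∀ r s, HasDerivAt (fun r => g r s) (g' r s) r) (a b r₀ : ℝ) :
    HasDerivAt (fun r => ∫ s in a..b, g r s) (∫ s in a..b, g' r₀ s) r₀ := by
  obtain ⟨C, hC⟩ := ((isCompact_closedBall r₀ 1).prod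
    (isCompact_uIcc (a := a) (b := b))).exists_bound_of_continuousOn hg'.continuousOn
  refine (intervalIntegral.hasDerivAt_integral_of_dominated_loc_of_deriv_le
    (bound := fun _ => C) (Metric.closedBall_mem_nhds r₀ one_pos)
    (.of_forall fun r => (hg r).aestronglyMeasurable) ((hg r₀).intervalIntegrable a b)
    (hg'.comp (Continuous.prodMk_right r₀)).aestronglyMeasurable
    (.of_forall fun s hs r hr => ?_) (by simp)
    (.of_forall fun s _ r _ => hd r s)).2
  exact hC (r, s) ⟨hr, uIoc_subset_uIcc hs⟩

/-- Uniqueness for linear ordinary differential equations with continuous coefficients. -/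
theorem eq_of_hasDerivAt_linear {A : ℝ → E →L[ℝ] E} (hA : Continuous A) {f g : ℝ → E}
    (hf : ∀ t, HasDerivAt f (A t (f t)) t) (hg : ∀ t, HasDerivAt g (A t (g t)) t)
    {t₀ : ℝ} (h₀ : f t₀ = g t₀) : f = g := by
  funext t
  set a := min t t₀ - 1
  set b := max t t₀ + 1
  have hmem : t ∈ Ioo a b ∧ t₀ ∈ Ioo a b := by
    have := min_le_left t t₀
    have := min_le_right t t₀
    have := le_max_left t t₀
    have := le_max_right t t₀
    refine ⟨⟨?_, ?_⟩, ⟨?_, ?_⟩⟩ <;> linarith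
  obtain ⟨C, hC⟩ := (isCompact_Icc (a := a) (b := b)).exists_bound_of_continuousOn hA.continuousOn
  refine ODE_solution_unique_of_mem_Ioo (v := fun t x => A t x) (s := fun _ => univ)
    (K := C.toNNReal) (fun s hs => ?_) hmem.2 (fun s _ => ⟨hf s, mem_univ _⟩)
    (fun s _ => ⟨hg s, mem_univ _⟩) h₀ hmem.1
  refine ((A s).lipschitz.weaken ?_).lipschitzOnWith
  rw [← NNReal.coe_le_coe]
  exact (hC s (Ioo_subset_Icc_self hs)).trans (Real.le_coe_toNNReal C)

variable [CompleteSpace E] {v : E → E} {Φ : ℝ → E → E}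

/-- The first variational equation: the spatial derivative of a `C¹` flow of a `C¹` vector field
solves the linearized equation along trajectories. -/
theorem hasDerivAt_fderiv_flow (hv : ContDiff ℝ 1 v)
    (hΦ : ContDiff ℝ 1 (fun p : ℝ × E => Φ p.1 p.2)) (hΦ0 : ∀ x, Φ 0 x = x)
    (hΦflow : ∀ ε x, HasDerivAt (fun e => Φ e x) (v (Φ ε x)) ε) (x h : E) (ε : ℝ) :
    HasDerivAt (fun e => fderiv ℝ (Φ e) x h) (fderiv ℝ v (Φ ε x) (fderiv ℝ (Φ ε) x h)) ε := by
  set G : ℝ × E → E := fun p => Φ p.1 p.2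
  have hΦe : ∀ e z, HasFDerivAt (Φ e) (fderiv ℝ G (e, z) ∘L ContinuousLinearMap.inr ℝ ℝ E) z :=
    fun e z => ((hΦ.differentiable one_ne_zero) (e, z)).hasFDerivAt.comp z
      (hasFDerivAt_prodMk_right e z)
  have hw : ∀ e z, fderiv ℝ (Φ e) z h = fderiv ℝ G (e, z) (0, h) := fun e z => by
    rw [(hΦe e z).fderiv]; simp
  have hline : ∀ r : ℝ, HasDerivAt (fun r : ℝ => x + r • h) h r := fun r => by
    simpa using ((hasDerivAt_id r).smul_const h).const_add x
  have hΦline : ∀ s r : ℝ,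
      HasDerivAt (fun r : ℝ => Φ s (x + r • h)) (fderiv ℝ (Φ s) (x + r • h) h) r := fun s r =>
    (hΦe s _).differentiableAt.hasFDerivAt.comp_hasDerivAt r (hline r)
  have hcG : Continuous G := hΦ.continuous
  have hcv : Continuous v := hv.continuous
  have hcDv : Continuous (fderiv ℝ v) := hv.continuous_fderiv one_ne_zero
  have hcDG : Continuous (fderiv ℝ G) := hΦ.continuous_fderiv one_ne_zero
  have hcont : Continuous (Function.uncurry fun r s : ℝ =>
      fderiv ℝ v (Φ s (x + r • h)) (fderiv ℝ (Φ s) (x + r • h) h)) := by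
    simp only [hw]
    have hp : Continuous fun p : ℝ × ℝ => (p.2, x + p.1 • h) := by fun_prop
    exact (hcDv.comp (hcG.comp hp)).clm_apply ((hcDG.comp hp).clm_apply continuous_const)
  have hcs : ∀ z, Continuous fun s => v (Φ s z) := fun z =>
    hcv.comp (hcG.comp (Continuous.prodMk_left z))
  have hint : ∀ e z, Φ e z = z + ∫ s in (0 : ℝ)..e, v (Φ s z) := fun e z => by
    rw [intervalIntegral.integral_eq_sub_of_hasDerivAt (fun s _ => hΦflow s z)
      ((hcs z).intervalIntegrable 0 e), hΦ0]
    abel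
  have hvar : ∀ e, fderiv ℝ (Φ e) x h =
      h + ∫ s in (0 : ℝ)..e, fderiv ℝ v (Φ s x) (fderiv ℝ (Φ s) x h) := fun e => by
    have h1 := (hline 0).add (hasDerivAt_intervalIntegral_of_continuous_deriv
      (g := fun r s => v (Φ s (x + r • h))) (fun r => hcs _) hcont
      (fun r s => ((hv.differentiable one_ne_zero) _).hasFDerivAt.comp_hasDerivAt r (hΦline s r))
      0 e 0)
    have h2 := (hΦline e 0).congr_of_eventuallyEq
      (.of_forall fun r => (hint e (x + r • h)).symm)
    simpa using h2.unique h1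
  have hc : Continuous fun s => fderiv ℝ v (Φ s x) (fderiv ℝ (Φ s) x h) := by
    simpa [Function.comp_def] using hcont.comp (Continuous.prodMk_right (0 : ℝ))
  exact ((hc.integral_hasStrictDerivAt 0 ε).hasDerivAt.const_add h).congr_of_eventuallyEq
    (.of_forall hvar)

/-- A vector field commuting with `v` is invariant under the flow of `v`. -/
theorem fderiv_flow_apply_of_commute {F : E → E} (hF : Differentiable ℝ F)
    (hv : ContDiff ℝ 1 v) (hbracket : ∀ x, fderiv ℝ v x (F x) = fderiv ℝ F x (v x))
    (hΦ : ContDiff ℝ 1 (fun p : ℝ × E => Φ p.1 p.2)) (hΦ0 : ∀ x, Φ 0 x = x)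
    (hΦflow : ∀ ε x, HasDerivAt (fun e => Φ e x) (v (Φ ε x)) ε) (ε : ℝ) (x : E) :
    fderiv ℝ (Φ ε) x (F x) = F (Φ ε x) := by
  refine congrFun (eq_of_hasDerivAt_linear (A := fun e => fderiv ℝ v (Φ e x))
    (f := fun e => fderiv ℝ (Φ e) x (F x)) (g := fun e => F (Φ e x)) (t₀ := 0)
    ((hv.continuous_fderiv one_ne_zero).comp (hΦ.continuous.comp (Continuous.prodMk_left x)))
    (hasDerivAt_fderiv_flow hv hΦ hΦ0 hΦflow x (F x)) (fun e => ?_) ?_) ε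
  · rw [hbracket]
    exact (hF _).hasFDerivAt.comp_hasDerivAt e (hΦflow e x)
  · rw [show Φ 0 = id from funext hΦ0]
    simp

end

/-- Infinitesimal criterion of Lie symmetry for autonomous first-order systems: if the Lie
bracket of `F` and `v` vanishes, then the flow `Φ` of `v` maps solutions of `ẏ = F(y)` to
solutions. -/
theorem commuting_vector_field_flow_is_symmetry (N : ℕ)
    (F v : (Fin N → ℝ) → Fin N → ℝ)
    (hF : ContDiff ℝ 1 F) (hv : ContDiff ℝ 1 v)
    (hbracket : ∀ x : Fin N → ℝ, fderiv ℝ v x (F x) = fderiv ℝ F x (v x))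
    (Φ : ℝ → (Fin N → ℝ) → Fin N → ℝ)
    (hΦ : ContDiff ℝ 1 (fun p : ℝ × (Fin N → ℝ) => Φ p.1 p.2))
    (hΦ0 : ∀ x, Φ 0 x = x)
    (hΦflow : ∀ (ε : ℝ) (x : Fin N → ℝ), HasDerivAt (fun e => Φ e x) (v (Φ ε x)) ε) :
    ∀ (I : Set ℝ) (y : ℝ → Fin N → ℝ),
      (∀ t ∈ I, HasDerivAt y (F (y t)) t) →
      ∀ ε : ℝ, ∀ t ∈ I, HasDerivAt (fun t' => Φ ε (y t')) (F (Φ ε (y t))) t := by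
  intro I y hy ε t ht
  have hd : DifferentiableAt ℝ (Φ ε) (y t) :=
    ((hΦ.differentiable one_ne_zero) (ε, y t)).comp (y t)
      (hasFDerivAt_prodMk_right ε (y t)).differentiableAt
  rw [← fderiv_flow_apply_of_commute (hF.differentiable one_ne_zero) hv hbracket hΦ hΦ0 hΦflow]
  exact hd.hasFDerivAt.comp_hasDerivAt t (hy t ht)
end

section
/- Suppose the vertex set {1,…,N} is partitioned into {s} and pairwise disjoint nonempty sets 𝒲_1, …, 𝒲_r with r ≥ 1, such that: (i) s is a source, i.e., W_{sk} = 0 for all k; and (ii) there are no edges between distinct subgraphs, i.e., W_{jk} = 0 whenever j ∈ 𝒲_η, k ∈ 𝒲_τ and η ≠ τ. For each η define the vector field G_η : ℝ^N → ℝ^N by (G_η)_j(θ) = F_j(θ) − ω_s if j ∈ 𝒲_η and (G_η)_j(θ) = 0 otherwise. Then the Lie bracket of F and G_η vanishes identically: (DG_η)(θ)(F(θ)) = (DF)(θ)(G_η(θ)) for all θ ∈ ℝ^N and all η ∈ {1,…,r}. Hence each G_η (the generator of the time evolution of the subgraph 𝒲_η in the rotating frame of the source) generates a Lie symmetry of the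 Kuramoto model. -/
/-- The restriction of the Kuramoto field to a subgraph `S`, in the rotating frame of a source
with natural frequency `ωs`. -/
noncomputable def kuramotoG {N : ℕ} (W α : Fin N → Fin N → ℝ) (ω : Fin N → ℝ) (σ : ℝ)
    (S : Finset (Fin N)) (ωs : ℝ) (θ : Fin N → ℝ) : Fin N → ℝ :=
  fun j => if j ∈ S then kuramotoF W α ω σ θ j - ωs else 0

/-- The Fréchet derivative of the Kuramoto vector field, coordinatewise. -/
noncomputable def kuramotoDeriv {N : ℕ} (W α : Fin N → Fin N → ℝ) (σ : ℝ) (θ : Fin N → ℝ)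
    (j : Fin N) : (Fin N → ℝ) →L[ℝ] ℝ :=
  σ • ∑ k, W j k • Real.cos (θ k - θ j - α j k) •
    (ContinuousLinearMap.proj (R := ℝ) (φ := fun _ : Fin N => ℝ) k -
      ContinuousLinearMap.proj (R := ℝ) (φ := fun _ : Fin N => ℝ) j)

theorem kuramotoDeriv_apply {N : ℕ} (W α : Fin N → Fin N → ℝ) (σ : ℝ) (θ v : Fin N → ℝ)
    (j : Fin N) :
    kuramotoDeriv W α σ θ j v =
      σ * ∑ k, Real.cos (θ k - θ j - α j k) * (W j k * (v k - v j)) := by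
  simp [kuramotoDeriv, mul_left_comm]

theorem hasFDerivAt_kuramotoF_coord {N : ℕ} (W α : Fin N → Fin N → ℝ) (ω : Fin N → ℝ)
    (σ : ℝ) (θ : Fin N → ℝ) (j : Fin N) :
    HasFDerivAt (fun x => kuramotoF W α ω σ x j) (kuramotoDeriv W α σ θ j) θ := by
  unfold kuramotoF kuramotoDeriv
  refine ((HasFDerivAt.fun_sum fun k _ => ?_).const_mul σ).const_add (ω j)
  exact ((((hasFDerivAt_apply k θ).sub (hasFDerivAt_apply j θ)).sub_const (α j k)).sin).const_mul
    (W j k)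

theorem fderiv_kuramotoF {N : ℕ} (W α : Fin N → Fin N → ℝ) (ω : Fin N → ℝ) (σ : ℝ)
    (θ : Fin N → ℝ) :
    fderiv ℝ (kuramotoF W α ω σ) θ = ContinuousLinearMap.pi (kuramotoDeriv W α σ θ) :=
  (hasFDerivAt_pi.2 (hasFDerivAt_kuramotoF_coord W α ω σ θ)).fderiv

theorem fderiv_kuramotoG {N : ℕ} (W α : Fin N → Fin N → ℝ) (ω : Fin N → ℝ) (σ : ℝ)
    (S : Finset (Fin N)) (ωs : ℝ) (θ : Fin N → ℝ) :
    fderiv ℝ (kuramotoG W α ω σ S ωs) θ =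
      ContinuousLinearMap.pi fun j => if j ∈ S then kuramotoDeriv W α σ θ j else 0 := by
  refine (hasFDerivAt_pi.2 fun j => ?_).fderiv
  unfold kuramotoG
  split_ifs
  · exact (hasFDerivAt_kuramotoF_coord W α ω σ θ j).sub_const ωs
  · exact hasFDerivAt_const 0 θ

theorem kuramotoF_source {N : ℕ} {W α : Fin N → Fin N → ℝ} {ω : Fin N → ℝ} {σ : ℝ} {s : Fin N}
    (hsource : ∀ k, W s k = 0) (θ : Fin N → ℝ) : kuramotoF W α ω σ θ s = ω s := by
  simp [kuramotoF, hsource]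

/-- If a source `s` feeds pairwise disjoint subgraphs `𝒲_1, …, 𝒲_r` with no edges between
distinct subgraphs, then the Lie bracket of the Kuramoto field `F` with each subgraph generator
`G_η` (the Koopman generator of `𝒲_η` in the rotating frame of the source) vanishes: each
`G_η` generates a Lie symmetry of the Kuramoto model. -/
theorem subgraph_rotating_frame_symmetry (N : ℕ) (hN : 1 ≤ N)
    (W α : Fin N → Fin N → ℝ) (ω : Fin N → ℝ) (σ : ℝ)
    (hW : ∀ j, W j j = 0) (hα : ∀ j, α j j = 0)
    (r : ℕ) (hr : 1 ≤ r) (s : Fin N) (𝒲 : Fin r → Finset (Fin N))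
    (hne : ∀ η, (𝒲 η).Nonempty)
    (hdisj : ∀ η τ, η ≠ τ → Disjoint (𝒲 η) (𝒲 τ))
    (hs : ∀ η, s ∉ 𝒲 η)
    (hcover : ∀ j : Fin N, j ≠ s → ∃ η, j ∈ 𝒲 η)
    (hsource : ∀ k, W s k = 0)
    (hnoedge : ∀ η τ, η ≠ τ → ∀ j ∈ 𝒲 η, ∀ k ∈ 𝒲 τ, W j k = 0) :
    ∀ (η : Fin r) (θ : Fin N → ℝ),
      fderiv ℝ (kuramotoG W α ω σ (𝒲 η) (ω s)) θ (kuramotoF W α ω σ θ) =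
        fderiv ℝ (kuramotoF W α ω σ) θ (kuramotoG W α ω σ (𝒲 η) (ω s) θ) := by
  intro η θ
  rw [fderiv_kuramotoF, fderiv_kuramotoG]
  ext j
  have hF := kuramotoF_source (α := α) (ω := ω) (σ := σ) hsource θ
  by_cases hj : j ∈ 𝒲 η
  · simp only [ContinuousLinearMap.pi_apply, hj, if_true, kuramotoDeriv_apply]
    congr 1
    refine Finset.sum_congr rfl fun k _ => ?_
    congr 1
    by_cases hk : k ∈ 𝒲 η
    · simp [kuramotoG, hj, hk]
    by_cases hks : k = s
    · subst hks
      simp [kuramotoG, hj, hk, hF]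
    obtain ⟨τ, hτ⟩ := hcover k hks
    have hne' : η ≠ τ := fun h => hk (h ▸ hτ)
    simp [hnoedge η τ hne' j hj k hτ]
  · simp only [ContinuousLinearMap.pi_apply, hj, if_false, kuramotoDeriv_apply,
      zero_apply]
    symm
    refine mul_eq_zero_of_right _ (Finset.sum_eq_zero fun k _ => mul_eq_zero_of_right _ ?_)
    by_cases hk : k ∈ 𝒲 η
    · by_cases hjs : j = s
      · simp [hjs, hsource]
      obtain ⟨τ, hτ⟩ := hcover j hjs
      have hne' : τ ≠ η := fun h => hj (h ▸ hτ)
      simp [hnoedge τ η hne' j hτ k hk]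
    · simp [kuramotoG, hj, hk]
end

section
/- Assume the vertex set {1,…,N} is partitioned into {s} and pairwise disjoint nonempty sets 𝒲_1, …, 𝒲_r with r > 1, where s is a source (W_{sk} = 0 for all k) and W_{jk} = 0 whenever j and k lie in distinct subgraphs. Let G_η be the symmetry vector field (G_η)_j = F_j − ω_s for j ∈ 𝒲_η and 0 otherwise. Suppose four pairwise distinct vertices a, b, c, d ≠ s satisfy: (A1) each x ∈ {a,b,c,d} has a unique incoming edge, coming from s, with identical weight and phase lag: W_{xk} = 0 for all k ≠ s, and W_{xs} e^{−iα_{xs}} takes the same nonzero value for all x ∈ {a,b,c,d}; (A2) ω_a = ω_b = ω_c = ω_d; (A3) the set {a,b,c,d} ∩ 𝒲_η has exactly 1, 2 or 3 elements. Then: (i) Σ_j F_j(θ) ∂C_{abcd}/∂θ_j(θ) = 0 wherever C_{abcd} is defined; (ii) the function h(θ) := Σ_j (G_η)_j(θ) ∂C_{abcd}/∂θ_j(θ) satisfies Σ_j F_j(θ) ∂h/∂θ_j(θ) = 0 wherever defined; and (iii) there exists θ at which the Jacobian of the map θ ↦ (C_{abcd}(θ), h(θ)) has rank 2, so C_{abcd}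 and h are functionally independent constants of motion. -/
open Topology in
theorem fderiv_fderiv_apply_of_eventually_eq_zero {E : Type*} [NormedAddCommGroup E]
    [NormedSpace ℝ E] {f : E → ℝ} {V G : E → E} {x : E} (hf : ContDiffAt ℝ 2 f x)
    (hV : DifferentiableAt ℝ V x) (hG : DifferentiableAt ℝ G x)
    (h : ∀ᶠ y in 𝓝 x, fderiv ℝ f y (V y) = 0) :
    fderiv ℝ (fun y => fderiv ℝ f y (G y)) x (V x) =
      fderiv ℝ f x (fderiv ℝ G x (V x) - fderiv ℝ V x (G x)) := by
  have hf' : DifferentiableAt ℝ (fderiv ℝ f) x :=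
    (hf.fderiv_right (m := 1) (by norm_num)).differentiableAt (by norm_num)
  have hsymm : IsSymmSndFDerivAt ℝ f x := hf.isSymmSndFDerivAt (by simp)
  have h0 : fderiv ℝ (fun y => fderiv ℝ f y (V y)) x (G x) = 0 := by
    have : (fun y => fderiv ℝ f y (V y)) =ᶠ[𝓝 x] fun _ => 0 := h
    simp [this.fderiv_eq]
  rw [fderiv_clm_apply hf' hV] at h0
  rw [fderiv_clm_apply hf' hG]
  simp only [add_apply, ContinuousLinearMap.comp_apply, ContinuousLinearMap.flip_apply,
    map_sub] at h0 ⊢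
  rw [hsymm.eq (V x) (G x)]
  linear_combination h0

theorem sum_mul_apply_single {N : ℕ} (L : (Fin N → ℝ) →L[ℝ] ℝ) (v : Fin N → ℝ) :
    ∑ j, v j * L (Pi.single j 1) = L v := by
  conv_rhs => rw [← Finset.univ_sum_single v, map_sum]
  refine Finset.sum_congr rfl fun j _ => ?_
  rw [← smul_eq_mul, ← map_smul, ← Pi.single_smul, smul_eq_mul, mul_one]

/-- The coefficients of the differential of the phase cross-ratio. -/
noncomputable def crossRatioGrad {N : ℕ} (a b c d : Fin N) (θ : Fin N → ℝ) (j : Fin N) : ℝ :=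
  if j = a then -(Real.sin ((θ d - θ c) / 2) * Real.sin ((θ d - θ b) / 2)) /
    (2 * Real.sin ((θ c - θ b) / 2) * Real.sin ((θ d - θ a) / 2) ^ 2)
  else if j = b then (Real.sin ((θ d - θ c) / 2) * Real.sin ((θ c - θ a) / 2)) /
    (2 * Real.sin ((θ c - θ b) / 2) ^ 2 * Real.sin ((θ d - θ a) / 2))
  else if j = c then -(Real.sin ((θ b - θ a) / 2) * Real.sin ((θ d - θ b) / 2)) /
    (2 * Real.sin ((θ c - θ b) / 2) ^ 2 * Real.sin ((θ d - θ a) / 2))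
  else if j = d then (Real.sin ((θ b - θ a) / 2) * Real.sin ((θ c - θ a) / 2)) /
    (2 * Real.sin ((θ c - θ b) / 2) * Real.sin ((θ d - θ a) / 2) ^ 2)
  else 0

theorem sum_four {N : ℕ} {a b c d : Fin N} (hab : a ≠ b) (hac : a ≠ c) (had : a ≠ d)
    (hbc : b ≠ c) (hbd : b ≠ d) (hcd : c ≠ d) (f : Fin N → ℝ) :
    ∑ x ∈ ({a, b, c, d} : Finset (Fin N)), f x = f a + f b + f c + f d := by
  rw [Finset.sum_insert (by simp [hab, hac, had]), Finset.sum_insert (by simp [hbc, hbd]),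
    Finset.sum_pair hcd]
  ring

section CrossRatio

variable {N : ℕ} {a b c d : Fin N} {θ : Fin N → ℝ}

theorem contDiffAt_crossRatioTheta
    (h : Real.sin ((θ c - θ b) / 2) * Real.sin ((θ d - θ a) / 2) ≠ 0) :
    ContDiffAt ℝ 2 (crossRatioTheta a b c d) θ := by
  unfold crossRatioTheta
  exact ContDiffAt.div (by fun_prop) (by fun_prop) h

theorem fderiv_crossRatioTheta (hab : a ≠ b) (hac : a ≠ c) (had : a ≠ d)
    (hbc : b ≠ c) (hbd : b ≠ d) (hcd : c ≠ d)
    (h : Real.sin ((θ c - θ b) / 2) * Real.sin ((θ d - θ a) / 2) ≠ 0) (v : Fin N → ℝ) :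
    fderiv ℝ (crossRatioTheta a b c d) θ v =
      ∑ x ∈ ({a, b, c, d} : Finset (Fin N)), crossRatioGrad a b c d θ x * v x := by
  have H : ∀ x y : Fin N, HasFDerivAt (fun θ : Fin N → ℝ => Real.sin ((θ x - θ y) / 2))
      (Real.cos ((θ x - θ y) / 2) • ((1 / 2 : ℝ) •
        (ContinuousLinearMap.proj (R := ℝ) (φ := fun _ : Fin N => ℝ) x -
          ContinuousLinearMap.proj y))) θ := by
    intro x y
    have hlin := (((hasFDerivAt_apply (𝕜 := ℝ) x θ).fun_sub (hasFDerivAt_apply y θ)).const_mul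
      (1 / 2 : ℝ)).sin
    simp only [one_div, inv_mul_eq_div] at hlin ⊢
    exact hlin
  have hC : HasFDerivAt (crossRatioTheta a b c d) _ θ :=
    ((H c a).mul (H d b)).mul ((hasDerivAt_inv h).comp_hasFDerivAt θ ((H c b).mul (H d a)))
  have e₁ := Real.sin_sub ((θ d - θ a) / 2) ((θ c - θ a) / 2)
  have e₂ := Real.sin_sub ((θ d - θ b) / 2) ((θ c - θ b) / 2)
  have e₃ := Real.sin_sub ((θ c - θ a) / 2) ((θ c - θ b) / 2)
  have e₄ := Real.sin_sub ((θ d - θ a) / 2) ((θ d - θ b) / 2)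
  rw [show (θ d - θ a) / 2 - (θ c - θ a) / 2 = (θ d - θ c) / 2 by ring] at e₁
  rw [show (θ d - θ b) / 2 - (θ c - θ b) / 2 = (θ d - θ c) / 2 by ring] at e₂
  rw [show (θ c - θ a) / 2 - (θ c - θ b) / 2 = (θ b - θ a) / 2 by ring] at e₃
  rw [show (θ d - θ a) / 2 - (θ d - θ b) / 2 = (θ b - θ a) / 2 by ring] at e₄
  rw [hC.fderiv, sum_four hab hac had hbc hbd hcd]
  simp [crossRatioGrad, hab.symm, hac.symm, had.symm, hbc.symm, hbd.symm, hcd.symm]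
  obtain ⟨h₁, h₂⟩ := mul_ne_zero_iff.mp h
  generalize Real.sin ((θ d - θ a) / 2) = sda at *
  generalize Real.sin ((θ d - θ b) / 2) = sdb at *
  generalize Real.sin ((θ c - θ a) / 2) = sca at *
  generalize Real.sin ((θ c - θ b) / 2) = scb at *
  generalize Real.sin ((θ d - θ c) / 2) = sdc at *
  generalize Real.sin ((θ b - θ a) / 2) = sba at *
  field_simp
  linear_combination (scb * sdb * v a) * e₁ - sca * sda * v b * e₂ + sdb * sda * v c * e₃
    - scb * sca * v d * e₄

theorem sum_crossRatioGrad_mul (hab : a ≠ b) (hac : a ≠ c) (had : a ≠ d)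
    (hbc : b ≠ c) (hbd : b ≠ d) (hcd : c ≠ d)
    (h : Real.sin ((θ c - θ b) / 2) * Real.sin ((θ d - θ a) / 2) ≠ 0) (A B C : ℝ) :
    ∑ x ∈ ({a, b, c, d} : Finset (Fin N)), crossRatioGrad a b c d θ x *
      (A + B * Real.cos (θ x) + C * Real.sin (θ x)) = 0 := by
  have hq : ∀ x, A + B * Real.cos (θ x) + C * Real.sin (θ x) =
      (A - B) * Real.sin (θ x / 2) ^ 2 + (A + B) * Real.cos (θ x / 2) ^ 2 +
        2 * C * (Real.sin (θ x / 2) * Real.cos (θ x / 2)) := by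
    intro x
    have e₁ := Real.cos_two_mul' (θ x / 2)
    have e₂ := Real.sin_two_mul (θ x / 2)
    rw [mul_div_cancel₀ _ two_ne_zero] at e₁ e₂
    linear_combination B * e₁ + C * e₂ - A * Real.sin_sq_add_cos_sq (θ x / 2)
  have key : ∀ x y, Real.sin ((θ x - θ y) / 2) =
      Real.sin (θ x / 2) * Real.cos (θ y / 2) - Real.cos (θ x / 2) * Real.sin (θ y / 2) := by
    intro x y
    rw [sub_div, Real.sin_sub]
  rw [sum_four hab hac had hbc hbd hcd]
  simp only [hq, crossRatioGrad, hab.symm, hac.symm, had.symm, hbc.symm, hbd.symm, hcd.symm,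
    if_true, if_false]
  obtain ⟨h₁, h₂⟩ := mul_ne_zero_iff.mp h
  field_simp
  simp only [key]
  ring

end CrossRatio

theorem sum_cos_or_sum_sin_ne_zero {ι : Type*} [DecidableEq ι] {T : Finset ι} {D θ : ι → ℝ}
    (hT : T.card = 1 ∨ T.card = 2) (hD : ∀ x ∈ T, D x ≠ 0)
    (hθ : ∀ x ∈ T, ∀ y ∈ T, x ≠ y → Real.sin (θ x - θ y) ≠ 0) :
    ¬ (∑ x ∈ T, D x * Real.cos (θ x) = 0 ∧ ∑ x ∈ T, D x * Real.sin (θ x) = 0) := by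
  rintro ⟨h₁, h₂⟩
  rcases hT with hT | hT
  · obtain ⟨x, rfl⟩ := Finset.card_eq_one.mp hT
    rw [Finset.sum_singleton] at h₁ h₂
    exact hD x (by simp) (by
      linear_combination Real.cos (θ x) * h₁ + Real.sin (θ x) * h₂ -
        D x * Real.sin_sq_add_cos_sq (θ x))
  · obtain ⟨x, y, hxy, rfl⟩ := Finset.card_eq_two.mp hT
    rw [Finset.sum_pair hxy] at h₁ h₂
    refine mul_ne_zero (hD x (by simp)) (hθ x (by simp) y (by simp) hxy) ?_
    rw [Real.sin_sub]
    linear_combination Real.cos (θ y) * h₂ - Real.sin (θ y) * h₁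

theorem contDiff_kuramotoF {N : ℕ} (W α : Fin N → Fin N → ℝ) (ω : Fin N → ℝ) (σ : ℝ) :
    ContDiff ℝ 2 (kuramotoF W α ω σ) := by
  unfold kuramotoF
  fun_prop

theorem contDiff_kuramotoG {N : ℕ} (W α : Fin N → Fin N → ℝ) (ω : Fin N → ℝ) (σ : ℝ)
    (S : Finset (Fin N)) (ωs : ℝ) : ContDiff ℝ 2 (kuramotoG W α ω σ S ωs) := by
  refine contDiff_pi.mpr fun j => ?_
  unfold kuramotoG
  split_ifs
  · exact (contDiff_pi.mp (contDiff_kuramotoF W α ω σ) j).sub contDiff_const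
  · exact contDiff_const

section Kuramoto

variable {N : ℕ} {W α : Fin N → Fin N → ℝ} {ω : Fin N → ℝ} {σ : ℝ}

theorem fderiv_kuramotoG_apply {S : Finset (Fin N)} {ωs : ℝ} (θ v : Fin N → ℝ) (x : Fin N) :
    fderiv ℝ (kuramotoG W α ω σ S ωs) θ v x =
      if x ∈ S then fderiv ℝ (kuramotoF W α ω σ) θ v x else 0 := by
  have hG := hasFDerivAt_pi'.mp (((contDiff_kuramotoG W α ω σ S ωs).differentiable
    (by norm_num)) θ).hasFDerivAt x
  have hF := hasFDerivAt_pi'.mp (((contDiff_kuramotoF W α ω σ).differentiable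
    (by norm_num)) θ).hasFDerivAt x
  split_ifs with hx
  · have hG' := hF.sub_const ωs
    simp only [kuramotoG, hx, if_true] at hG
    exact DFunLike.congr_fun (hG.unique hG') v
  · simp only [kuramotoG, hx, if_false] at hG
    exact DFunLike.congr_fun (hG.unique (hasFDerivAt_const 0 θ)) v

theorem kuramotoF_of_source {s : Fin N} (hs : ∀ k, W s k = 0) (θ : Fin N → ℝ) :
    kuramotoF W α ω σ θ s = ω s := by
  simp [kuramotoF, hs]

theorem kuramotoF_of_unique_edge {s x : Fin N} {w : ℂ} (hx : ∀ k, k ≠ s → W x k = 0)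
    (hw : (W x s : ℂ) * Complex.exp (-Complex.I * (α x s : ℂ)) = w) (θ : Fin N → ℝ) :
    kuramotoF W α ω σ θ x =
      ω x + σ * (w.re * Real.sin (θ s - θ x) + w.im * Real.cos (θ s - θ x)) := by
  have he : Complex.exp (-Complex.I * (α x s : ℂ)) =
      (Real.cos (α x s) : ℂ) - (Real.sin (α x s) : ℂ) * Complex.I := by
    rw [show -Complex.I * (α x s : ℂ) = ((-α x s : ℝ) : ℂ) * Complex.I by push_cast; ring,
      Complex.exp_mul_I, ← Complex.ofReal_cos, ← Complex.ofReal_sin, Real.cos_neg, Real.sin_neg]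
    push_cast
    ring
  have hre : w.re = W x s * Real.cos (α x s) := by
    rw [← hw, he, Complex.re_ofReal_mul]
    simp [-Complex.ofReal_cos, -Complex.ofReal_sin]
  have him : w.im = -(W x s * Real.sin (α x s)) := by
    rw [← hw, he, Complex.im_ofReal_mul]
    simp [-Complex.ofReal_cos, -Complex.ofReal_sin]
  rw [kuramotoF, Finset.sum_eq_single s (fun k _ hk => by simp [hx k hk]) (by simp),
    Real.sin_sub (θ s - θ x), hre, him]
  ring

theorem fderiv_kuramotoF_of_unique_edge {s x : Fin N} {w : ℂ} (hx : ∀ k, k ≠ s → W x k = 0)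
    (hw : (W x s : ℂ) * Complex.exp (-Complex.I * (α x s : ℂ)) = w) (θ v : Fin N → ℝ) :
    fderiv ℝ (kuramotoF W α ω σ) θ v x =
      σ * (w.re * Real.cos (θ s - θ x) - w.im * Real.sin (θ s - θ x)) * (v s - v x) := by
  have hF := hasFDerivAt_pi'.mp (((contDiff_kuramotoF W α ω σ).differentiable
    (by norm_num)) θ).hasFDerivAt x
  simp only [kuramotoF_of_unique_edge hx hw] at hF
  have hd : HasFDerivAt (fun θ : Fin N → ℝ => θ s - θ x)
      (ContinuousLinearMap.proj (R := ℝ) (φ := fun _ : Fin N => ℝ) s -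
          ContinuousLinearMap.proj x) θ :=
    (hasFDerivAt_apply (𝕜 := ℝ) s θ).fun_sub (hasFDerivAt_apply x θ)
  have hF' := (((hd.sin.const_mul w.re).add (hd.cos.const_mul w.im)).const_mul σ).const_add (ω x)
  have := DFunLike.congr_fun (hF.unique hF') v
  simp at this
  rw [this]
  ring

end Kuramoto

theorem exists_sum_mul_quadrature_ne_zero {ι : Type*} {T : Finset ι} {D θ : ι → ℝ} {w : ℂ}
    (hw : w ≠ 0)
    (h : ¬ (∑ x ∈ T, D x * Real.cos (θ x) = 0 ∧ ∑ x ∈ T, D x * Real.sin (θ x) = 0)) :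
    ∃ t : ℝ, ∑ x ∈ T, D x * (w.re * Real.cos (t - θ x) - w.im * Real.sin (t - θ x)) ≠ 0 := by
  set X := ∑ x ∈ T, D x * Real.cos (θ x) with hX
  set Y := ∑ x ∈ T, D x * Real.sin (θ x) with hY
  have key : ∀ t, ∑ x ∈ T, D x * (w.re * Real.cos (t - θ x) - w.im * Real.sin (t - θ x)) =
      (w.re * Real.cos t - w.im * Real.sin t) * X +
        (w.re * Real.sin t + w.im * Real.cos t) * Y := by
    intro t
    rw [hX, hY, Finset.mul_sum, Finset.mul_sum, ← Finset.sum_add_distrib]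
    refine Finset.sum_congr rfl fun x _ => ?_
    rw [Real.cos_sub, Real.sin_sub]
    ring
  by_contra! hall
  have h₀ := hall 0
  have h₁ := hall (Real.pi / 2)
  rw [key] at h₀ h₁
  simp only [Real.cos_zero, Real.sin_zero, Real.cos_pi_div_two, Real.sin_pi_div_two] at h₀ h₁
  have hn : w.re ^ 2 + w.im ^ 2 ≠ 0 := by
    have := (Complex.normSq_pos.mpr hw).ne'
    rwa [Complex.normSq_apply, ← sq, ← sq] at this
  refine h ⟨?_, ?_⟩ <;> refine (mul_eq_zero.mp ?_).resolve_left hn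
  · linear_combination w.re * h₀ - w.im * h₁
  · linear_combination w.im * h₀ + w.re * h₁

theorem rank_two_of_ne_zero {n : Type*} [Fintype n] {u v : n → ℝ} {i j : n}
    (hui : u i = 0) (hvi : v i ≠ 0) (huj : u j ≠ 0) : (Matrix.of ![u, v]).rank = 2 := by
  have hli : LinearIndependent ℝ (Matrix.of ![u, v]).row := by
    change LinearIndependent ℝ ![u, v]
    refine LinearIndependent.pair_iff.mpr fun p q hpq => ?_
    have hi := congrFun hpq i
    have hj := congrFun hpq j
    simp only [Pi.add_apply, Pi.smul_apply, smul_eq_mul, Pi.zero_apply, hui, mul_zero,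
      zero_add] at hi hj
    obtain rfl : q = 0 := (mul_eq_zero.mp hi).resolve_right hvi
    rw [zero_mul, add_zero] at hj
    exact ⟨(mul_eq_zero.mp hj).resolve_right huj, rfl⟩
  simpa using hli.rank_matrix

/-- Theorem 3A (symmetry-generated constants of motion): if four vertices `a,b,c,d` with
identical natural frequencies receive a unique incoming edge from the source `s`, all with the
same complex weight, and one, two or three of them belong to a subgraph `𝒲_η`, then the
cross-ratio `C_{abcd}` and its image `h = S_η[C_{abcd}]` under the symmetry generator are
functionally independent constants of motion. -/
theorem symmetry_generated_constants_A (N : ℕ) (hN : 4 ≤ N)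
    (W α : Fin N → Fin N → ℝ) (ω : Fin N → ℝ) (σ : ℝ) (hσ : σ ≠ 0)
    (hW : ∀ j, W j j = 0) (hα : ∀ j, α j j = 0)
    (hαbound : ∀ j k, |α j k| ≤ Real.pi / 2)
    (r : ℕ) (hr : 1 < r) (s : Fin N) (𝒲 : Fin r → Finset (Fin N))
    (hne : ∀ η', (𝒲 η').Nonempty)
    (hdisj : ∀ η' τ, η' ≠ τ → Disjoint (𝒲 η') (𝒲 τ))
    (hsnot : ∀ η', s ∉ 𝒲 η')
    (hcover : ∀ j : Fin N, j ≠ s → ∃ η', j ∈ 𝒲 η')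
    (hsource : ∀ k, W s k = 0)
    (hnoedge : ∀ η' τ, η' ≠ τ → ∀ j ∈ 𝒲 η', ∀ k ∈ 𝒲 τ, W j k = 0)
    (η : Fin r)
    (a b c d : Fin N) (hab : a ≠ b) (hac : a ≠ c) (had : a ≠ d)
    (hbc : b ≠ c) (hbd : b ≠ d) (hcd : c ≠ d)
    (has : a ≠ s) (hbs : b ≠ s) (hcs : c ≠ s) (hds : d ≠ s)
    (hA1a : ∀ x ∈ ({a, b, c, d} : Finset (Fin N)), ∀ k, k ≠ s → W x k = 0)
    (hA1b : ∃ wval : ℂ, wval ≠ 0 ∧ ∀ x ∈ ({a, b, c, d} : Finset (Fin N)),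
      (W x s : ℂ) * Complex.exp (-Complex.I * (α x s : ℂ)) = wval)
    (hA2 : ω a = ω b ∧ ω b = ω c ∧ ω c = ω d)
    (hA3 : 1 ≤ (({a, b, c, d} : Finset (Fin N)) ∩ 𝒲 η).card ∧
      (({a, b, c, d} : Finset (Fin N)) ∩ 𝒲 η).card ≤ 3) :
    (∀ θ : Fin N → ℝ,
        Real.sin ((θ c - θ b) / 2) * Real.sin ((θ d - θ a) / 2) ≠ 0 →
        ∑ j, kuramotoF W α ω σ θ j *
          fderiv ℝ (crossRatioTheta a b c d) θ (Pi.single j 1) = 0) ∧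
    (∀ θ : Fin N → ℝ,
        Real.sin ((θ c - θ b) / 2) * Real.sin ((θ d - θ a) / 2) ≠ 0 →
        ∑ j, kuramotoF W α ω σ θ j *
          fderiv ℝ (fun θ' => ∑ k, kuramotoG W α ω σ (𝒲 η) (ω s) θ' k *
            fderiv ℝ (crossRatioTheta a b c d) θ' (Pi.single k 1)) θ (Pi.single j 1) = 0) ∧
    (∃ θ : Fin N → ℝ,
        Real.sin ((θ c - θ b) / 2) * Real.sin ((θ d - θ a) / 2) ≠ 0 ∧
        Matrix.rank (Matrix.of
          ![fun j => fderiv ℝ (crossRatioTheta a b c d) θ (Pi.single j 1),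
            fun j => fderiv ℝ (fun θ' => ∑ k, kuramotoG W α ω σ (𝒲 η) (ω s) θ' k *
              fderiv ℝ (crossRatioTheta a b c d) θ' (Pi.single k 1)) θ (Pi.single j 1)]) = 2) := by
  simp only [sum_mul_apply_single]
  obtain ⟨w, hw0, hw⟩ := hA1b
  set Q : Finset (Fin N) := {a, b, c, d} with hQ
  have hωQ : ∀ x ∈ Q, ω x = ω a := by
    obtain ⟨h₁, h₂, h₃⟩ := hA2
    simp [hQ, h₁, h₂, h₃]
  have hsS : s ∉ 𝒲 η := hsnot η
  have hdenom : ∀ θ : Fin N → ℝ,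
      Real.sin ((θ c - θ b) / 2) * Real.sin ((θ d - θ a) / 2) ≠ 0 →
      ∀ᶠ θ' in nhds θ, Real.sin ((θ' c - θ' b) / 2) * Real.sin ((θ' d - θ' a) / 2) ≠ 0 := by
    intro θ hθ
    have hcont : Continuous fun θ' : Fin N → ℝ =>
        Real.sin ((θ' c - θ' b) / 2) * Real.sin ((θ' d - θ' a) / 2) := by fun_prop
    exact hcont.continuousAt.eventually_ne hθ
  have hdC := fun (θ : Fin N → ℝ) h => fderiv_crossRatioTheta (θ := θ) hab hac had hbc hbd hcd h
  have hdF : Differentiable ℝ (kuramotoF W α ω σ) :=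
    (contDiff_kuramotoF W α ω σ).differentiable (by norm_num)
  have hdG : Differentiable ℝ (kuramotoG W α ω σ (𝒲 η) (ω s)) :=
    (contDiff_kuramotoG W α ω σ (𝒲 η) (ω s)).differentiable (by norm_num)
  have hconst : ∀ θ : Fin N → ℝ,
      Real.sin ((θ c - θ b) / 2) * Real.sin ((θ d - θ a) / 2) ≠ 0 →
      fderiv ℝ (crossRatioTheta a b c d) θ (kuramotoF W α ω σ θ) = 0 := by
    intro θ hθ
    rw [hdC θ hθ, ← sum_crossRatioGrad_mul hab hac had hbc hbd hcd hθ (ω a)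
      (σ * (w.re * Real.sin (θ s) + w.im * Real.cos (θ s)))
      (σ * (w.im * Real.sin (θ s) - w.re * Real.cos (θ s)))]
    refine Finset.sum_congr rfl fun x hx => ?_
    rw [kuramotoF_of_unique_edge (hA1a x hx) (hw x hx), hωQ x hx, Real.sin_sub, Real.cos_sub]
    ring
  refine ⟨hconst, fun θ hθ => ?_, ?_⟩
  · rw [fderiv_fderiv_apply_of_eventually_eq_zero (contDiffAt_crossRatioTheta hθ) (hdF θ) (hdG θ)
      ((hdenom θ hθ).mono hconst), hdC θ hθ]
    refine Finset.sum_eq_zero fun x hx => ?_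
    rw [Pi.sub_apply, fderiv_kuramotoG_apply,
      fderiv_kuramotoF_of_unique_edge (hA1a x hx) (hw x hx),
      fderiv_kuramotoF_of_unique_edge (hA1a x hx) (hw x hx), kuramotoF_of_source hsource]
    by_cases hxS : x ∈ 𝒲 η
    · simp only [kuramotoG, hxS, hsS, if_true, if_false]
      ring
    · simp [kuramotoG, hxS, hsS]
  · let φ : ℝ → Fin N → ℝ := fun t j =>
      if j = a then 0 else if j = b then 1 else if j = c then 2 else if j = d then 3 else t
    have hφa : ∀ t, φ t a = 0 := fun t => by simp [φ]
    have hφb : ∀ t, φ t b = 1 := fun t => by simp [φ, hab.symm]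
    have hφc : ∀ t, φ t c = 2 := fun t => by simp [φ, hac.symm, hbc.symm]
    have hφd : ∀ t, φ t d = 3 := fun t => by simp [φ, had.symm, hbd.symm, hcd.symm]
    have hφs : ∀ t, φ t s = t := fun t => by simp [φ, has.symm, hbs.symm, hcs.symm, hds.symm]
    have hsin : ∀ u : ℝ, 0 < u → u ≤ 3 → Real.sin u ≠ 0 := fun u h₀ h₃ =>
      (Real.sin_pos_of_pos_of_lt_pi h₀ (h₃.trans_lt Real.pi_gt_three)).ne'
    have hφ : ∀ t, Real.sin ((φ t c - φ t b) / 2) * Real.sin ((φ t d - φ t a) / 2) ≠ 0 := by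
      intro t
      rw [hφa, hφb, hφc, hφd]
      exact mul_ne_zero (hsin _ (by norm_num) (by norm_num)) (hsin _ (by norm_num) (by norm_num))
    have hφQ : ∀ t, ∀ x ∈ Q, φ t x = φ 0 x := by
      simp [hQ, hφa, hφb, hφc, hφd]
    have hgrad : ∀ t, crossRatioGrad a b c d (φ t) = crossRatioGrad a b c d (φ 0) := by
      intro t
      funext j
      simp only [crossRatioGrad, hφa, hφb, hφc, hφd]
    set D := crossRatioGrad a b c d (φ 0) with hD
    have hD0 : ∀ x ∈ Q, D x ≠ 0 := by
      have h₁ := hsin (1 / 2) (by norm_num) (by norm_num)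
      have h₂ := hsin 1 (by norm_num) (by norm_num)
      have h₃ := hsin (3 / 2) (by norm_num) (by norm_num)
      norm_num at h₁
      simp [hQ, hD, crossRatioGrad, hφa, hφb, hφc, hφd, hab.symm, hac.symm, had.symm, hbc.symm,
        hbd.symm, hcd.symm]
      norm_num [h₁, h₂, h₃]
    have hdist : ∀ x ∈ Q, ∀ y ∈ Q, x ≠ y → Real.sin (φ 0 x - φ 0 y) ≠ 0 := by
      have hlt : ∀ x ∈ Q, ∀ y ∈ Q, φ 0 x < φ 0 y → Real.sin (φ 0 y - φ 0 x) ≠ 0 := by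
        intro x hx y hy hxy
        refine hsin _ (sub_pos.mpr hxy) ?_
        have hbd : ∀ z ∈ Q, 0 ≤ φ 0 z ∧ φ 0 z ≤ 3 := by
          norm_num [hQ, hφa, hφb, hφc, hφd]
        linarith [hbd x hx, hbd y hy]
      intro x hx y hy hxy
      have hne : φ 0 x ≠ φ 0 y := by
        simp only [hQ, Finset.mem_insert, Finset.mem_singleton] at hx hy
        rcases hx with hx | hx | hx | hx <;> rcases hy with hy | hy | hy | hy <;>
          first
          | exact absurd (hx.trans hy.symm) hxy
          | (rw [hx, hy]; norm_num [hφa, hφb, hφc, hφd])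
      rcases hne.lt_or_gt with h | h
      · rw [← neg_sub, Real.sin_neg]
        exact neg_ne_zero.mpr (hlt x hx y hy h)
      · exact hlt y hy x hx h
    have hcosQ : ∑ x ∈ Q, D x * Real.cos (φ 0 x) = 0 := by
      simpa using sum_crossRatioGrad_mul hab hac had hbc hbd hcd (hφ 0) 0 1 0
    have hsinQ : ∑ x ∈ Q, D x * Real.sin (φ 0 x) = 0 := by
      simpa using sum_crossRatioGrad_mul hab hac had hbc hbd hcd (hφ 0) 0 0 1
    have hT : ¬ (∑ x ∈ Q ∩ 𝒲 η, D x * Real.cos (φ 0 x) = 0 ∧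
        ∑ x ∈ Q ∩ 𝒲 η, D x * Real.sin (φ 0 x) = 0) := by
      by_cases hcard : (Q ∩ 𝒲 η).card ≤ 2
      · refine sum_cos_or_sum_sin_ne_zero (by omega)
          (fun x hx => hD0 x (Finset.mem_inter.mp hx).1)
          fun x hx y hy => hdist x (Finset.mem_inter.mp hx).1 y (Finset.mem_inter.mp hy).1
      · have hQcard : Q.card = 4 := by
          simp [hQ, hab, hac, had, hbc, hbd, hcd]
        have hsdiff := Finset.card_sdiff_add_card_inter Q (𝒲 η)
        have hcompl := sum_cos_or_sum_sin_ne_zero (T := Q \ 𝒲 η) (D := D) (θ := φ 0)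
          (by omega) (fun x hx => hD0 x (Finset.mem_sdiff.mp hx).1)
          fun x hx y hy => hdist x (Finset.mem_sdiff.mp hx).1 y (Finset.mem_sdiff.mp hy).1
        rintro ⟨h₁, h₂⟩
        rw [← Finset.sum_inter_add_sum_sdiff Q (𝒲 η), h₁, zero_add] at hcosQ
        rw [← Finset.sum_inter_add_sum_sdiff Q (𝒲 η), h₂, zero_add] at hsinQ
        exact hcompl ⟨hcosQ, hsinQ⟩
    obtain ⟨t, ht⟩ := exists_sum_mul_quadrature_ne_zero hw0 hT
    have hsQ : ∀ x ∈ Q, x ≠ s := by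
      simp [hQ, has, hbs, hcs, hds]
    have hCs : ∀ θ : Fin N → ℝ,
        Real.sin ((θ c - θ b) / 2) * Real.sin ((θ d - θ a) / 2) ≠ 0 →
        fderiv ℝ (crossRatioTheta a b c d) θ (Pi.single s 1) = 0 := by
      intro θ hθ
      rw [hdC θ hθ]
      exact Finset.sum_eq_zero fun x hx => by simp [hsQ x hx]
    refine ⟨φ t, hφ t, rank_two_of_ne_zero (i := s) (j := a) (hCs _ (hφ t)) ?_ ?_⟩
    · have hcomm := fderiv_fderiv_apply_of_eventually_eq_zero (V := fun _ => Pi.single s 1)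
        (contDiffAt_crossRatioTheta (hφ t)) (differentiableAt_const _) (hdG (φ t))
        ((hdenom _ (hφ t)).mono hCs)
      rw [hcomm, hdC _ (hφ t), hgrad]
      have hsum : ∑ x ∈ Q, D x * (fderiv ℝ (kuramotoG W α ω σ (𝒲 η) (ω s)) (φ t)
          (Pi.single s 1) - fderiv ℝ (fun _ : Fin N → ℝ => (Pi.single s 1 : Fin N → ℝ)) (φ t)
            (kuramotoG W α ω σ (𝒲 η) (ω s) (φ t))) x =
          σ * ∑ x ∈ Q ∩ 𝒲 η, D x * (w.re * Real.cos (t - φ 0 x) -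
            w.im * Real.sin (t - φ 0 x)) := by
        rw [← Finset.filter_mem_eq_inter, Finset.sum_filter, Finset.mul_sum]
        refine Finset.sum_congr rfl fun x hx => ?_
        rw [Pi.sub_apply, fderiv_kuramotoG_apply,
          fderiv_kuramotoF_of_unique_edge (hA1a x hx) (hw x hx), hφs, hφQ t x hx]
        split_ifs
        · simp [hsQ x hx]
          ring
        · simp
      rw [hsum]
      exact mul_ne_zero hσ ht
    · rw [hdC _ (hφ t), hgrad, Finset.sum_eq_single a (fun x _ hx => by simp [hx])
        (by simp)]
      simpa using hD0 a (by simp [hQ])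
end

section
/- Consider the zero-phase-lag Kuramoto model on undirected binary star graphs with σ ≠ 0. (a) On the star S₄ with core vertex 1 and leaves 2, 3, 4 (i.e., W_{1k} = W_{k1} = 1 for k ∈ {2,3,4} and all other entries of W zero), for every choice of natural frequencies ω, the cross-ratio C_{1234} is NOT a constant of motion: there exists θ ∈ ℝ^4 at which C_{1234} is defined and Σ_j F_j(θ) ∂C_{1234}/∂θ_j(θ) ≠ 0. (b) On the star S₅ with core vertex 5 and leaves 1, 2, 3, 4 (i.e., W_{5k} = W_{k5} = 1 for k ∈ {1,2,3,4} and all other entries zero), if ω_1 = ω_2 = ω_3 = ω_4, then Σ_j F_j(θ) ∂C_{1234}/∂θ_j(θ) = 0 at every θ where C_{1234} is defined. Hence S₅ is the smallest undirected binary star graph for which a cross-ratio is a constant of motion. -/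
/-- Weight matrix of the undirected binary star `S₄` with core vertex `0` and leaves `1,2,3`. -/
noncomputable def starW4 : Fin 4 → Fin 4 → ℝ :=
  fun j k => if (j = 0 ∧ k ≠ 0) ∨ (k = 0 ∧ j ≠ 0) then 1 else 0

/-- Weight matrix of the undirected binary star `S₅` with core vertex `4` and leaves
`0,1,2,3`. -/
noncomputable def starW5 : Fin 5 → Fin 5 → ℝ :=
  fun j k => if (j = 4 ∧ k ≠ 4) ∨ (k = 4 ∧ j ≠ 4) then 1 else 0

/-- The derivative of the cross-ratio along a vector `v`, in quotient-rule form. -/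
theorem sum_mul_fderiv_crossRatioTheta {N : ℕ} (a b c d : Fin N) (θ v : Fin N → ℝ)
    (h : Real.sin ((θ c - θ b) / 2) * Real.sin ((θ d - θ a) / 2) ≠ 0) :
    ∑ j, v j * fderiv ℝ (crossRatioTheta a b c d) θ (Pi.single j 1) =
      ((Real.cos ((θ c - θ a) / 2) * ((v c - v a) / 2) * Real.sin ((θ d - θ b) / 2) +
          Real.sin ((θ c - θ a) / 2) * (Real.cos ((θ d - θ b) / 2) * ((v d - v b) / 2))) *
          (Real.sin ((θ c - θ b) / 2) * Real.sin ((θ d - θ a) / 2)) -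
        Real.sin ((θ c - θ a) / 2) * Real.sin ((θ d - θ b) / 2) *
          (Real.cos ((θ c - θ b) / 2) * ((v c - v b) / 2) * Real.sin ((θ d - θ a) / 2) +
          Real.sin ((θ c - θ b) / 2) * (Real.cos ((θ d - θ a) / 2) * ((v d - v a) / 2)))) /
        (Real.sin ((θ c - θ b) / 2) * Real.sin ((θ d - θ a) / 2)) ^ 2 := by
  have hdiff : DifferentiableAt ℝ (crossRatioTheta a b c d) θ := by
    unfold crossRatioTheta
    fun_prop (disch := exact h)
  have hsum : ∑ j, v j * fderiv ℝ (crossRatioTheta a b c d) θ (Pi.single j 1) =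
      fderiv ℝ (crossRatioTheta a b c d) θ v := by
    conv_rhs => rw [pi_eq_sum_univ' v, map_sum]
    refine Finset.sum_congr rfl fun j _ => ?_
    rw [map_smul, smul_eq_mul]
  have hline : ∀ i, HasDerivAt (fun t : ℝ => (θ + t • v) i) (v i) 0 := fun i => by
    simpa using ((hasDerivAt_id (0 : ℝ)).mul_const (v i)).const_add (θ i)
  have hsin : ∀ i j, HasDerivAt (fun t : ℝ => Real.sin (((θ + t • v) i - (θ + t • v) j) / 2))
      (Real.cos ((θ i - θ j) / 2) * ((v i - v j) / 2)) 0 := fun i j => by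
    simpa using (((hline i).sub (hline j)).div_const 2).sin
  have hquot := ((hsin c a).mul (hsin d b)).div ((hsin c b).mul (hsin d a)) (by simpa using h)
  have hdir : HasDerivAt (fun t : ℝ => crossRatioTheta a b c d (θ + t • v))
      (fderiv ℝ (crossRatioTheta a b c d) θ v) 0 := hdiff.hasFDerivAt.hasLineDerivAt v
  rw [hsum, hdir.unique hquot]
  simp

/-- A difference of values of a sinusoid, multiplied by the cosine of half the difference of the
arguments. -/
theorem cos_half_sub_mul_sin_sub_sin (φ x y : ℝ) :
    Real.cos ((x - y) / 2) * (Real.sin (φ - x) - Real.sin (φ - y)) =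
      -Real.sin ((x - y) / 2) * (Real.cos (φ - x) + Real.cos (φ - y)) := by
  have hx : φ - x = (φ - (x + y) / 2) - (x - y) / 2 := by ring
  have hy : φ - y = (φ - (x + y) / 2) + (x - y) / 2 := by ring
  rw [hx, hy]
  generalize φ - (x + y) / 2 = u
  generalize (x - y) / 2 = w
  rw [Real.sin_sub, Real.sin_add, Real.cos_sub, Real.cos_add]
  ring

theorem sum_starW4_mul_zero (f : Fin 4 → ℝ) : ∑ k, starW4 0 k * f k = f 1 + f 2 + f 3 := by
  simp [starW4, Fin.sum_univ_four]

theorem sum_starW4_mul_two (f : Fin 4 → ℝ) : ∑ k, starW4 2 k * f k = f 0 := by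
  simp [starW4]

theorem sum_starW5_mul_leaf (j : Fin 5) (hj : j ≠ 4) (f : Fin 5 → ℝ) :
    ∑ k, starW5 j k * f k = f 4 := by
  simp [starW5, hj]

/-- On `S₄`, where the core and the third vertex are in phase, the cross-ratio has nonzero
derivative along the flow unless those two vertices have equal velocities. -/
theorem sum_kuramotoF_starW4_ne_zero (σ : ℝ) (ω : Fin 4 → ℝ) (x y : ℝ)
    (hx : Real.sin (x / 2) ≠ 0) (hy : Real.sin (y / 2) ≠ 0) (hyx : Real.sin ((y - x) / 2) ≠ 0)
    (hω : ω 2 - ω 0 - σ * (Real.sin x + Real.sin y) ≠ 0) :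
    Real.sin (((![0, x, 0, y] : Fin 4 → ℝ) 2 - (![0, x, 0, y] : Fin 4 → ℝ) 1) / 2) *
        Real.sin (((![0, x, 0, y] : Fin 4 → ℝ) 3 - (![0, x, 0, y] : Fin 4 → ℝ) 0) / 2) ≠ 0 ∧
      ∑ j, kuramotoF starW4 (fun _ _ => 0) ω σ ![0, x, 0, y] j *
        fderiv ℝ (crossRatioTheta (0 : Fin 4) 1 2 3) ![0, x, 0, y] (Pi.single j 1) ≠ 0 := by
  have hden : Real.sin (((![0, x, 0, y] : Fin 4 → ℝ) 2 - (![0, x, 0, y] : Fin 4 → ℝ) 1) / 2) *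
      Real.sin (((![0, x, 0, y] : Fin 4 → ℝ) 3 - (![0, x, 0, y] : Fin 4 → ℝ) 0) / 2) ≠ 0 := by
    simpa [neg_div] using And.intro hx hy
  refine ⟨hden, ?_⟩
  rw [sum_mul_fderiv_crossRatioTheta _ _ _ _ _ _ hden]
  have hvel : kuramotoF starW4 (fun _ _ => 0) ω σ ![0, x, 0, y] 2 -
      kuramotoF starW4 (fun _ _ => 0) ω σ ![0, x, 0, y] 0 =
      ω 2 - ω 0 - σ * (Real.sin x + Real.sin y) := by
    simp only [kuramotoF, sum_starW4_mul_zero, sum_starW4_mul_two]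
    simp
    ring
  refine div_ne_zero ?_ (pow_ne_zero 2 hden)
  rw [hvel]
  simp [neg_div, hx, hy, hyx, hω]

/-- In the zero-phase-lag Kuramoto model with `σ ≠ 0`: (a) on the star `S₄` (core `0`,
leaves `1,2,3`), for every choice of natural frequencies the cross-ratio of the four vertices
is NOT a constant of motion; (b) on the star `S₅` (core `4`, leaves `0,1,2,3`), if the four
leaves have identical natural frequencies, the cross-ratio of the leaves is a constant of
motion. Hence `S₅` is the smallest undirected binary star admitting a conserved cross-ratio. -/
theorem star_graph_smallest_conserved_crossratio (σ : ℝ) (hσ : σ ≠ 0) :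
    (∀ ω : Fin 4 → ℝ,
      ∃ θ : Fin 4 → ℝ,
        Real.sin ((θ 2 - θ 1) / 2) * Real.sin ((θ 3 - θ 0) / 2) ≠ 0 ∧
        ∑ j, kuramotoF starW4 (fun _ _ => 0) ω σ θ j *
          fderiv ℝ (crossRatioTheta (0 : Fin 4) 1 2 3) θ (Pi.single j 1) ≠ 0) ∧
    (∀ ω : Fin 5 → ℝ, ω 0 = ω 1 → ω 1 = ω 2 → ω 2 = ω 3 →
      ∀ θ : Fin 5 → ℝ,
        Real.sin ((θ 2 - θ 1) / 2) * Real.sin ((θ 3 - θ 0) / 2) ≠ 0 →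
        ∑ j, kuramotoF starW5 (fun _ _ => 0) ω σ θ j *
          fderiv ℝ (crossRatioTheta (0 : Fin 5) 1 2 3) θ (Pi.single j 1) = 0) := by
  refine ⟨fun ω => ?_, fun ω h01 h12 h23 θ hθ => ?_⟩
  · have hquarter : Real.sin (Real.pi / 2 / 2) ≠ 0 :=
      (Real.sin_pos_of_pos_of_lt_pi (by positivity) (by linarith [Real.pi_pos])).ne'
    by_cases h : ω 2 - ω 0 - σ = 0
    · refine ⟨_, sum_kuramotoF_starW4_ne_zero σ ω (-(Real.pi / 2)) Real.pi ?_ ?_ ?_ ?_⟩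
      · simpa [neg_div] using hquarter
      · simp
      · exact (Real.sin_pos_of_pos_of_lt_pi (by linarith [Real.pi_pos])
          (by linarith [Real.pi_pos])).ne'
      · simp only [Real.sin_neg, Real.sin_pi_div_two, Real.sin_pi]
        intro h'
        exact hσ (by linarith)
    · refine ⟨_, sum_kuramotoF_starW4_ne_zero σ ω (Real.pi / 2) Real.pi hquarter ?_ ?_ ?_⟩
      · simp
      · convert hquarter using 2
        ring
      · simpa using h
  · rw [sum_mul_fderiv_crossRatioTheta _ _ _ _ _ _ hθ]
    have hcos := cos_half_sub_mul_sin_sub_sin (θ 4)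
    simp only [kuramotoF, sum_starW5_mul_leaf 0 (by decide), sum_starW5_mul_leaf 1 (by decide),
      sum_starW5_mul_leaf 2 (by decide), sum_starW5_mul_leaf 3 (by decide), sub_zero, h01, h12,
      h23]
    rw [div_eq_zero_iff]
    left
    linear_combination
      σ / 2 * Real.sin ((θ 3 - θ 1) / 2) *
          (Real.sin ((θ 2 - θ 1) / 2) * Real.sin ((θ 3 - θ 0) / 2)) * hcos (θ 2) (θ 0) +
        σ / 2 * Real.sin ((θ 2 - θ 0) / 2) *
          (Real.sin ((θ 2 - θ 1) / 2) * Real.sin ((θ 3 - θ 0) / 2)) * hcos (θ 3) (θ 1) -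
        σ / 2 * Real.sin ((θ 2 - θ 0) / 2) * Real.sin ((θ 3 - θ 1) / 2) *
          Real.sin ((θ 3 - θ 0) / 2) * hcos (θ 2) (θ 1) -
        σ / 2 * Real.sin ((θ 2 - θ 0) / 2) * Real.sin ((θ 3 - θ 1) / 2) *
          Real.sin ((θ 2 - θ 1) / 2) * hcos (θ 3) (θ 0)
end
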